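/- arXiv:2506.01165 — 11 statements merged into one kernel-verified Lean document; each statement's English description precedes it below -/
import Mathlib

section
/- Let W be a real normed vector space and let I : W → ℝ be a continuous function with I(0) = 0 such that I is coercive (I(u) → ∞ as ‖u‖ → ∞) and such that, for every u ∈ W ∖ {0}, the map t ↦ I(t·u) is strictly increasing on (0,∞). For u ∈ W ∖ {0} let t(u) > 0 be the unique positive real with I(t(u)·u) = 1. Then the map u ↦ t(u) is continuous on W ∖ {0}; consequently the radial projection π_rad : W ∖ {0} → M := {u ∈ W : I(u) = 1}, π_rad(u) = t(u)·u, is continuous. -/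
/-- continuity of the radial projection onto M = {I = 1}. -/
theorem stmt_1 {W : Type*} [NormedAddCommGroup W] [NormedSpace ℝ W]
    (I : W → ℝ) (hIcont : Continuous I) (hI0 : I 0 = 0)
    (hIcoercive : ∀ c : ℝ, ∃ R : ℝ, ∀ u : W, R ≤ ‖u‖ → c ≤ I u)
    (hImono : ∀ u : W, u ≠ 0 → StrictMonoOn (fun t : ℝ => I (t • u)) (Set.Ioi (0:ℝ)))
    (T : W → ℝ)
    (hT : ∀ u : W, u ≠ 0 → 0 < T u ∧ I (T u • u) = 1) :
    ContinuousOn T {u : W | u ≠ 0} ∧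
    ContinuousOn (fun u : W => T u • u) {u : W | u ≠ 0} := by
  have hcomp : ∀ t : ℝ, Continuous fun v : W => I (t • v) := fun t =>
    hIcont.comp (continuous_const_smul t)
  have hlt : ∀ v : W, v ≠ 0 → ∀ t : ℝ, 0 < t → (I (t • v) < 1 ↔ t < T v) := fun v hv t ht => by
    rw [← (hT v hv).2]
    exact (hImono v hv).lt_iff_lt ht (hT v hv).1
  have hgt : ∀ v : W, v ≠ 0 → ∀ t : ℝ, 0 < t → (1 < I (t • v) ↔ T v < t) := fun v hv t ht => by
    rw [← (hT v hv).2]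
    exact (hImono v hv).lt_iff_lt (hT v hv).1 ht
  have hTcont : ContinuousOn T {u : W | u ≠ 0} := by
    intro u hu
    refine tendsto_order.2 ⟨fun a ha => ?_, fun b hb => ?_⟩
    · obtain ⟨c, hc, hcu⟩ := exists_between (max_lt ha (hT u hu).1)
      obtain ⟨hac, hc0⟩ := max_lt_iff.1 hc
      filter_upwards [self_mem_nhdsWithin, mem_nhdsWithin_of_mem_nhds
        ((hcomp c).continuousAt.eventually_lt_const ((hlt u hu c hc0).2 hcu))] with v hv hIv
      exact hac.trans ((hlt v hv c hc0).1 hIv)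
    · have hb0 : 0 < b := (hT u hu).1.trans hb
      filter_upwards [self_mem_nhdsWithin, mem_nhdsWithin_of_mem_nhds
        ((hcomp b).continuousAt.eventually_const_lt ((hgt u hu b hb0).2 hb))] with v hv hIv
      exact (hgt v hv b hb0).1 hIv
  exact ⟨hTcont, hTcont.smul continuousOn_id⟩
end

section
/- Let W be a real normed vector space and let I : W → ℝ be a continuous even function with I(0) = 0 such that, for every u ∈ W ∖ {0}, the map t ↦ I(t·u) is strictly increasing on (0,∞). Set M = {u ∈ W : I(u) = 1}. Let A_0 ⊆ M be symmetric (A_0 = −A_0) and let w̃ ∈ M ∖ A_0. Then (1−τ)·v + τ·w̃ ≠ 0 for every v ∈ A_0 and every τ ∈ [0,1]. -/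
/-- segments from a symmetric subset A₀ of M to w̃ ∈ M \ A₀ avoid the origin. -/
theorem stmt_4 {W : Type*} [NormedAddCommGroup W] [NormedSpace ℝ W]
    (I : W → ℝ) (hIcont : Continuous I) (hIeven : ∀ u : W, I (-u) = I u)
    (hI0 : I 0 = 0)
    (hImono : ∀ u : W, u ≠ 0 → StrictMonoOn (fun t : ℝ => I (t • u)) (Set.Ioi (0:ℝ)))
    (A0 : Set W) (hA0M : A0 ⊆ {u : W | I u = 1}) (hA0sym : A0 = -A0)
    (w : W) (hwM : I w = 1) (hw : w ∉ A0) :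
    ∀ v ∈ A0, ∀ τ ∈ Set.Icc (0:ℝ) 1, (1 - τ) • v + τ • w ≠ 0 := by
  intro v hv τ hτ h
  have ne_zero_of_eq_one : ∀ u : W, I u = 1 → u ≠ 0 := by
    rintro u hu rfl
    exact one_ne_zero (hu.symm.trans hI0)
  have hvM : I v = 1 := hA0M hv
  have hw0 := ne_zero_of_eq_one w hwM
  have hτ0 : 0 < τ := by
    refine hτ.1.lt_of_ne ?_
    rintro rfl
    exact ne_zero_of_eq_one v hvM (by simpa using h)
  have hτ1 : 0 < 1 - τ := by
    refine (sub_nonneg.2 hτ.2).lt_of_ne fun h1 => hw0 ?_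
    rw [← h1, zero_smul, zero_add] at h
    exact (smul_eq_zero.1 h).resolve_left hτ0.ne'
  have hv_eq : v = -((τ / (1 - τ)) • w) := by
    rw [div_eq_inv_mul, mul_smul, ← smul_neg, eq_inv_smul_iff₀ hτ1.ne']
    exact eq_neg_of_add_eq_zero_left h
  have hs : τ / (1 - τ) = 1 := by
    refine (hImono w hw0).injOn (div_pos hτ0 hτ1) (Set.mem_Ioi.2 one_pos) ?_
    rw [one_smul, hwM, ← hIeven, ← hv_eq, hvM]
  rw [hs, one_smul] at hv_eq
  apply hw
  rw [hA0sym]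
  change -w ∈ A0
  rwa [← hv_eq]
end

section
/- Let W be a reflexive real Banach space (so every bounded sequence in W has a weakly convergent subsequence). Let I, J : W → ℝ be continuous even functions with I(0) = J(0) = 0, J(u) > 0 for every u ≠ 0, I coercive (I(u) → ∞ as ‖u‖ → ∞), such that for every u ≠ 0 the maps t ↦ I(t·u) and t ↦ J(t·u) are strictly increasing on (0,∞), I is weakly sequentially lower semicontinuous, and J is weakly sequentially continuous (u_j ⇀ u implies J(u_j) → J(u)). Set M = {u ∈ W : I(u) = 1} and let π_rad(u) = t(u)·u, where t(u) is the unique positive real with I(t(u)·u) = 1. Let λ̄ > 0, A_0 = {u ∈ M : J(u) ≥ 1/λ̄}, and let w̃ ∈ M with J(w̃) < 1/λ̄. Then the set A_1 = {π_rad((1−τ)·v + τ·w̃) : v ∈ A_0, 0 ≤ τ ≤ 1} is well defined (i.e., (1−τ)·v + τ·w̃ ≠ 0 for all v ∈ A_0, τ ∈ [0,1]), there exists ε > 0 such that J(u) > ε for all u ∈ A_1, and every sequence in A_1 has a subsequence that converges weakly to a nonzero element of W. -/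
/-- Weak convergence of a sequence in a normed space: convergence against every
continuous linear functional. -/
def WeakConv {W : Type*} [NormedAddCommGroup W] [NormedSpace ℝ W]
    (u : ℕ → W) (l : W) : Prop :=
  ∀ φ : W →L[ℝ] ℝ, Filter.Tendsto (fun n => φ (u n)) Filter.atTop (nhds (φ l))

theorem WeakConv.comp {W : Type*} [NormedAddCommGroup W] [NormedSpace ℝ W]
    {u : ℕ → W} {l : W} (h : WeakConv u l) {φ : ℕ → ℕ} (hφ : StrictMono φ) :
    WeakConv (u ∘ φ) l :=
  fun f => (h f).comp hφ.tendsto_atTop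

/-- A convex combination of `v` and `w` is nonzero when `I v ≤ I w` and `J w < J v` for functionals
`I`, `J` that are strictly increasing along rays. -/
theorem convexCombination_ne_zero {W : Type*} [NormedAddCommGroup W] [NormedSpace ℝ W]
    {I J : W → ℝ} (hIeven : ∀ u : W, I (-u) = I u) (hJeven : ∀ u : W, J (-u) = J u)
    (hImono : ∀ u : W, u ≠ 0 → StrictMonoOn (fun t : ℝ => I (t • u)) (Set.Ioi (0 : ℝ)))
    (hJmono : ∀ u : W, u ≠ 0 → StrictMonoOn (fun t : ℝ => J (t • u)) (Set.Ioi (0 : ℝ)))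
    {v w : W} (hv : v ≠ 0) (hw : w ≠ 0) (hI : I v ≤ I w) (hJ : J w < J v)
    {τ : ℝ} (hτ : τ ∈ Set.Icc (0 : ℝ) 1) : (1 - τ) • v + τ • w ≠ 0 := by
  intro h
  rcases hτ.1.eq_or_lt with rfl | h0
  · simp [hv] at h
  rcases hτ.2.eq_or_lt with rfl | h1
  · simp [hw] at h
  have hs : 0 < (1 - τ) / τ := div_pos (by linarith) h0
  have hwv : w = -(((1 - τ) / τ) • v) := by
    rw [div_eq_inv_mul, mul_smul, eq_neg_of_add_eq_zero_left h, smul_neg, neg_neg,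
      inv_smul_smul₀ h0.ne']
  rw [hwv, hIeven] at hI
  rw [hwv, hJeven] at hJ
  have hle := ((hImono v hv).le_iff_le (a := 1) (b := (1 - τ) / τ)
    (Set.mem_Ioi.2 one_pos) hs).1 (by simpa using hI)
  have hlt := ((hJmono v hv).lt_iff_lt (a := (1 - τ) / τ) (b := 1) hs
    (Set.mem_Ioi.2 one_pos)).1 (by simpa using hJ)
  exact hlt.not_ge hle

/-- If `y j` converges weakly to a nonzero limit and the scalars `t j` are bounded away from zero,
then `t j • y j` cannot converge weakly to zero. -/
theorem WeakConv.ne_zero_of_smul {W : Type*} [NormedAddCommGroup W] [NormedSpace ℝ W]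
    {y : ℕ → W} {a b : W} {t : ℕ → ℝ} {c : ℝ} (hy : WeakConv y a) (ha : a ≠ 0)
    (hc : 0 < c) (ht : ∀ n, c ≤ t n) (hty : WeakConv (fun n => t n • y n) b) : b ≠ 0 := by
  rintro rfl
  obtain ⟨f, -, hf⟩ := exists_dual_vector ℝ a (norm_ne_zero_iff.2 ha)
  have hlim : Filter.Tendsto (fun n => f (y n)) Filter.atTop (nhds 0) := by
    have h := (hty f).norm.const_mul c⁻¹
    rw [map_zero, norm_zero, mul_zero] at h
    refine squeeze_zero_norm (fun n => ?_) h
    rw [map_smul, norm_smul, Real.norm_of_nonneg (hc.le.trans (ht n)), ← mul_assoc]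
    refine le_mul_of_one_le_left (norm_nonneg _) ?_
    rw [inv_mul_eq_div, one_le_div hc]
    exact ht n
  have h := tendsto_nhds_unique (hy f) hlim
  rw [hf] at h
  exact ha (norm_eq_zero.1 (by simpa using h))

/-- the set A₁ is well defined, J is bounded away from zero on A₁, and A₁
is weakly compact in W \ {0}. -/
theorem stmt_5 {W : Type*} [NormedAddCommGroup W] [NormedSpace ℝ W] [CompleteSpace W]
    -- reflexivity: every bounded sequence has a weakly convergent subsequence
    (hrefl : ∀ u : ℕ → W, (∃ C : ℝ, ∀ n, ‖u n‖ ≤ C) →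
      ∃ (v : W) (φ : ℕ → ℕ), StrictMono φ ∧ WeakConv (u ∘ φ) v)
    (I J : W → ℝ) (hIcont : Continuous I) (hJcont : Continuous J)
    (hIeven : ∀ u : W, I (-u) = I u) (hJeven : ∀ u : W, J (-u) = J u)
    (hI0 : I 0 = 0) (hJ0 : J 0 = 0)
    (hJpos : ∀ u : W, u ≠ 0 → 0 < J u)
    (hIcoercive : ∀ c : ℝ, ∃ R : ℝ, ∀ u : W, R ≤ ‖u‖ → c ≤ I u)
    (hImono : ∀ u : W, u ≠ 0 → StrictMonoOn (fun t : ℝ => I (t • u)) (Set.Ioi (0:ℝ)))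
    (hJmono : ∀ u : W, u ≠ 0 → StrictMonoOn (fun t : ℝ => J (t • u)) (Set.Ioi (0:ℝ)))
    (hIwlsc : ∀ (u : ℕ → W) (v : W), WeakConv u v →
      I v ≤ Filter.liminf (fun n => I (u n)) Filter.atTop)
    (hJwc : ∀ (u : ℕ → W) (v : W), WeakConv u v →
      Filter.Tendsto (fun n => J (u n)) Filter.atTop (nhds (J v)))
    -- the radial projection parameter t(u)
    (T : W → ℝ) (hT : ∀ u : W, u ≠ 0 → 0 < T u ∧ I (T u • u) = 1)
    (lam : ℝ) (hlam : 0 < lam)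
    (A0 : Set W) (hA0 : A0 = {u : W | I u = 1 ∧ 1/lam ≤ J u})
    (w : W) (hwM : I w = 1) (hwJ : J w < 1/lam)
    (A1 : Set W)
    (hA1 : A1 = {x : W | ∃ v ∈ A0, ∃ τ ∈ Set.Icc (0:ℝ) 1,
      x = T ((1-τ) • v + τ • w) • ((1-τ) • v + τ • w)}) :
    -- A₁ is well defined
    (∀ v ∈ A0, ∀ τ ∈ Set.Icc (0:ℝ) 1, (1-τ) • v + τ • w ≠ 0) ∧
    -- J is bounded away from 0 on A₁
    (∃ ε : ℝ, 0 < ε ∧ ∀ u ∈ A1, ε < J u) ∧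
    -- A₁ is weakly compact in W \ {0}
    (∀ u : ℕ → W, (∀ n, u n ∈ A1) →
      ∃ v : W, v ≠ 0 ∧ ∃ φ : ℕ → ℕ, StrictMono φ ∧ WeakConv (u ∘ φ) v) := by
  have hne : ∀ {u : W}, I u = 1 → u ≠ 0 := by
    rintro u hu rfl
    simp [hI0] at hu
  have hlam' : 0 < 1 / lam := one_div_pos.2 hlam
  have hJne : ∀ {u : W}, 1 / lam ≤ J u → u ≠ 0 := by
    rintro u hu rfl
    linarith
  have hcomb : ∀ v : W, I v ≤ 1 → 1 / lam ≤ J v → ∀ τ ∈ Set.Icc (0 : ℝ) 1,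
      (1 - τ) • v + τ • w ≠ 0 := fun v hIv hJv τ hτ =>
    convexCombination_ne_zero hIeven hJeven hImono hJmono (hJne hJv) (hne hwM)
      (hIv.trans hwM.ge) (hwJ.trans_le hJv) hτ
  subst hA0 hA1
  obtain ⟨R, hR⟩ := hIcoercive 2
  have hbdd : ∀ u : W, I u = 1 → ‖u‖ ≤ R := by
    intro u hu
    by_contra! h
    linarith [hR u h.le]
  obtain ⟨δ, hδ, hIδ⟩ : ∃ δ > 0, ∀ u : W, ‖u‖ < δ → I u < 1 := by
    have h : ∀ᶠ u in nhds (0 : W), I u < 1 :=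
      hIcont.continuousAt.eventually_lt_const (by simp [hI0])
    obtain ⟨δ, hδ, h⟩ := Metric.eventually_nhds_iff.1 h
    exact ⟨δ, hδ, fun u hu => h (by simpa using hu)⟩
  have hcompact : ∀ u : ℕ → W, (∀ n, u n ∈ {x : W | ∃ v ∈ {u : W | I u = 1 ∧ 1/lam ≤ J u},
      ∃ τ ∈ Set.Icc (0:ℝ) 1, x = T ((1-τ) • v + τ • w) • ((1-τ) • v + τ • w)}) →
      ∃ v : W, v ≠ 0 ∧ ∃ φ : ℕ → ℕ, StrictMono φ ∧ WeakConv (u ∘ φ) v := by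
    intro u hu
    choose v hv τ hτ huv using hu
    set y : ℕ → W := fun n => (1 - τ n) • v n + τ n • w with hy
    have hT' : ∀ n, 0 < T (y n) ∧ I (T (y n) • y n) = 1 := fun n =>
      hT _ (hcomb _ (hv n).1.le (hv n).2 _ (hτ n))
    have huy : ∀ n, u n = T (y n) • y n := huv
    have hIu : ∀ n, I (u n) = 1 := fun n => by rw [huy]; exact (hT' n).2
    have hyR : ∀ n, ‖y n‖ ≤ R := fun n => by
      have := convex_closedBall (0 : W) R
        (mem_closedBall_zero_iff.2 (hbdd _ (hv n).1)) (mem_closedBall_zero_iff.2 (hbdd _ hwM))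
        (sub_nonneg.2 (hτ n).2) (hτ n).1 (sub_add_cancel _ _)
      exact mem_closedBall_zero_iff.1 this
    have hRpos : 0 < R := (norm_pos_iff.2 (hne hwM)).trans_le (hbdd _ hwM)
    have hTlow : ∀ n, δ / R ≤ T (y n) := fun n => by
      rw [div_le_iff₀ hRpos]
      have h : δ ≤ ‖u n‖ := by
        by_contra! h
        linarith [hIδ _ h, hIu n]
      rw [huy, norm_smul, Real.norm_of_nonneg (hT' n).1.le] at h
      exact h.trans (mul_le_mul_of_nonneg_left (hyR n) (hT' n).1.le)
    obtain ⟨u', φ, hφ, hu'⟩ := hrefl u ⟨R, fun n => hbdd _ (hIu n)⟩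
    obtain ⟨v', ψ, hψ, hv'⟩ := hrefl (v ∘ φ) ⟨R, fun n => hbdd _ (hv _).1⟩
    obtain ⟨τ', hτ', χ, hχ, hτlim⟩ :=
      isCompact_Icc.tendsto_subseq (x := τ ∘ φ ∘ ψ) (fun n => hτ _)
    refine ⟨u', ?_, φ, hφ, hu'⟩
    have hIv' : I v' ≤ 1 := by
      have h := hIwlsc _ _ hv'
      simpa [Function.comp_def, fun n => (hv n).1] using h
    have hJv' : 1 / lam ≤ J v' := ge_of_tendsto' (hJwc _ _ hv') fun n => (hv _).2
    have hylim : WeakConv (y ∘ φ ∘ ψ ∘ χ) ((1 - τ') • v' + τ' • w) := fun f => by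
      have h := ((hτlim.const_sub 1).mul (hv'.comp hχ f)).add (hτlim.mul_const (f w))
      simpa [hy, Function.comp_def] using h
    refine hylim.ne_zero_of_smul (hcomb _ hIv' hJv' _ hτ') (div_pos hδ hRpos)
      (fun n => hTlow (φ (ψ (χ n)))) ?_
    have h := hu'.comp (hψ.comp hχ)
    rwa [show (u ∘ φ) ∘ ψ ∘ χ = fun n => T (y (φ (ψ (χ n)))) • (y ∘ φ ∘ ψ ∘ χ) n from
      funext fun n => huy _] at h
  refine ⟨fun v hv => hcomb v hv.1.le hv.2, ?_, hcompact⟩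
  by_contra! hcon
  choose u hu hJu using fun n : ℕ => hcon (1 / ((n : ℝ) + 1)) Nat.one_div_pos_of_nat
  obtain ⟨v, hv, φ, hφ, hlim⟩ := hcompact u hu
  have hle : J v ≤ 0 := le_of_tendsto_of_tendsto' (hJwc _ _ hlim)
    ((tendsto_one_div_add_atTop_nhds_zero_nat (𝕜 := ℝ)).comp hφ.tendsto_atTop) fun n => hJu _
  exact (hJpos v hv).not_ge hle
end

section
/- Let W be a real normed vector space equipped with a continuous map W × [0,∞) → W, (u,t) ↦ u_t, satisfying (H1) (u_{t1})_{t2} = u_{t1·t2} for all u ∈ W and t1, t2 ≥ 0, and (H3) u_0 = 0 and u_1 = u for all u ∈ W. Let s > 0 and let I : W → ℝ be continuous with I(0) = 0, I(u) > 0 for every u ≠ 0, and I(u_t) = t^s·I(u) for all u ∈ W and t ≥ 0. Set M = {u ∈ W : I(u) = 1} and, for u ≠ 0, π(u) = u_{t_u} with t_u = I(u)^{−1/s}. Let B_0 ⊆ M be nonempty and D_2 = {w_t : w ∈ B_0, t ≥ 0}. Then M ∖ B_0 ⊆ W ∖ D_2, π maps W ∖ D_2 into M ∖ B_0, and the restriction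 π|_{W∖D_2} : W ∖ D_2 → M ∖ B_0 is a homotopy equivalence (with subspace topologies), a homotopy inverse being the inclusion M ∖ B_0 ↪ W ∖ D_2; in fact the map (u,τ) ↦ u_{(1−τ)·t_u + τ} is a homotopy in W ∖ D_2 between π|_{W∖D_2} (composed with the inclusion) and the identity of W ∖ D_2. -/
/-- π restricts to a homotopy equivalence W \ D₂ → M \ B₀ whose homotopy
inverse is the inclusion, the homotopy being (u,τ) ↦ u_{(1-τ)t_u + τ}. -/
theorem stmt_7 {W : Type*} [NormedAddCommGroup W] [NormedSpace ℝ W]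
    (sc : W → ℝ → W)
    (hsc_cont : ContinuousOn (fun p : W × ℝ => sc p.1 p.2) (Set.univ ×ˢ Set.Ici (0:ℝ)))
    (hH1 : ∀ (u : W) (t1 t2 : ℝ), 0 ≤ t1 → 0 ≤ t2 → sc (sc u t1) t2 = sc u (t1 * t2))
    (hH3a : ∀ u : W, sc u 0 = 0) (hH3b : ∀ u : W, sc u 1 = u)
    (s : ℝ) (hs : 0 < s)
    (I : W → ℝ) (hIcont : Continuous I) (hI0 : I 0 = 0)
    (hIpos : ∀ u : W, u ≠ 0 → 0 < I u)
    (hIscale : ∀ (u : W) (t : ℝ), 0 ≤ t → I (sc u t) = t ^ s * I u)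
    (B0 : Set W) (hB0 : B0 ⊆ {u : W | I u = 1}) (hB0ne : B0.Nonempty)
    (D2 : Set W) (hD2 : D2 = {x : W | ∃ w ∈ B0, ∃ t : ℝ, 0 ≤ t ∧ x = sc w t}) :
    -- M \ B₀ ⊆ W \ D₂
    (∀ u : W, I u = 1 → u ∉ B0 → u ∉ D2) ∧
    -- π maps W \ D₂ into M \ B₀
    (∀ u : W, u ∉ D2 → I (sc u (I u ^ (-1/s))) = 1 ∧ sc u (I u ^ (-1/s)) ∉ B0) ∧
    ContinuousOn (fun u : W => sc u (I u ^ (-1/s))) {u : W | u ∉ D2} ∧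
    -- π ∘ inclusion is the identity of M \ B₀
    (∀ u : W, I u = 1 → u ∉ B0 → sc u (I u ^ (-1/s)) = u) ∧
    -- the homotopy (u,τ) ↦ u_{(1-τ)t_u + τ} between π and the identity of W \ D₂
    (∀ u : W, u ∉ D2 → ∀ τ ∈ Set.Icc (0:ℝ) 1,
      sc u ((1 - τ) * (I u ^ (-1/s)) + τ) ∉ D2) ∧
    ContinuousOn (fun p : W × ℝ => sc p.1 ((1 - p.2) * (I p.1 ^ (-1/s)) + p.2))
      ({u : W | u ∉ D2} ×ˢ Set.Icc (0:ℝ) 1) ∧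
    (∀ u : W, u ∉ D2 →
      sc u ((1 - (0:ℝ)) * (I u ^ (-1/s)) + 0) = sc u (I u ^ (-1/s))) ∧
    (∀ u : W, u ∉ D2 → sc u ((1 - (1:ℝ)) * (I u ^ (-1/s)) + 1) = u) ∧
    -- hence π|_{W \ D₂} is a homotopy equivalence, the inclusion being a homotopy inverse
    (∃ e : ContinuousMap.HomotopyEquiv {u : W // u ∉ D2} {u : W // I u = 1 ∧ u ∉ B0},
      (∀ x : {u : W // u ∉ D2}, ((e.toFun x : {u : W // I u = 1 ∧ u ∉ B0}) : W)
        = sc (x : W) (I (x : W) ^ (-1/s))) ∧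
      (∀ y : {u : W // I u = 1 ∧ u ∉ B0}, ((e.invFun y : {u : W // u ∉ D2}) : W) = (y : W))) := by
  have hzero : (0 : W) ∈ D2 := by
    obtain ⟨w, hw⟩ := hB0ne
    rw [hD2]
    exact ⟨w, hw, 0, le_rfl, (hH3a w).symm⟩
  have hpos : ∀ u : W, u ∉ D2 → 0 < I u := fun u hu =>
    hIpos u fun h => hu (h ▸ hzero)
  have hB0D2 : B0 ⊆ D2 := fun w hw => by
    rw [hD2]
    exact ⟨w, hw, 1, zero_le_one, (hH3b w).symm⟩
  have hscale : ∀ (u : W) (t : ℝ), u ∉ D2 → 0 < t → sc u t ∉ D2 := by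
    intro u t hu ht hmem
    rw [hD2] at hmem hu
    obtain ⟨w, hw, r, hr, h⟩ := hmem
    refine hu ⟨w, hw, r * t⁻¹, mul_nonneg hr (inv_nonneg.2 ht.le), ?_⟩
    rw [← hH1 w r t⁻¹ hr (inv_nonneg.2 ht.le), ← h, hH1 u t t⁻¹ ht.le (inv_nonneg.2 ht.le),
      mul_inv_cancel₀ ht.ne', hH3b]
  have hsphere : ∀ u : W, I u = 1 → u ∉ B0 → u ∉ D2 := by
    intro u hu huB hmem
    rw [hD2] at hmem
    obtain ⟨w, hw, t, ht, rfl⟩ := hmem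
    rw [hIscale w t ht, hB0 hw, mul_one, ← Real.one_rpow s,
      Real.rpow_left_inj ht zero_le_one hs.ne'] at hu
    rw [hu, hH3b] at huB
    exact huB hw
  have htpos : ∀ u : W, u ∉ D2 → 0 < I u ^ (-1/s) := fun u hu =>
    Real.rpow_pos_of_pos (hpos u hu) _
  have hproj : ∀ u : W, u ∉ D2 →
      I (sc u (I u ^ (-1/s))) = 1 ∧ sc u (I u ^ (-1/s)) ∉ B0 := by
    intro u hu
    refine ⟨?_, fun h => hscale u _ hu (htpos u hu) (hB0D2 h)⟩
    rw [hIscale u _ (htpos u hu).le, ← Real.rpow_mul (hpos u hu).le, div_mul_cancel₀ _ hs.ne',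
      Real.rpow_neg_one, inv_mul_cancel₀ (hpos u hu).ne']
  have hfix : ∀ u : W, I u = 1 → u ∉ B0 → sc u (I u ^ (-1/s)) = u := by
    intro u hu _
    rw [hu, Real.one_rpow, hH3b]
  have hparam : ∀ u : W, u ∉ D2 → ∀ τ ∈ Set.Icc (0:ℝ) 1,
      0 < (1 - τ) * (I u ^ (-1/s)) + τ := by
    intro u hu τ hτ
    have h := htpos u hu
    rcases hτ.1.eq_or_lt with rfl | h0
    · simpa using h
    · exact add_pos_of_nonneg_of_pos (mul_nonneg (sub_nonneg.2 hτ.2) h.le) h0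
  have hhomot : ContinuousOn (fun p : W × ℝ => sc p.1 ((1 - p.2) * (I p.1 ^ (-1/s)) + p.2))
      ({u : W | u ∉ D2} ×ˢ Set.Icc (0:ℝ) 1) := by
    have hpow : ContinuousOn (fun p : W × ℝ => I p.1 ^ (-1/s))
        ({u : W | u ∉ D2} ×ˢ Set.Icc (0:ℝ) 1) :=
      (hIcont.comp continuous_fst).continuousOn.rpow_const
        fun p hp => Or.inl (hpos p.1 hp.1).ne'
    have hmap : ContinuousOn (fun p : W × ℝ => (p.1, (1 - p.2) * (I p.1 ^ (-1/s)) + p.2))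
        ({u : W | u ∉ D2} ×ˢ Set.Icc (0:ℝ) 1) := by
      fun_prop
    exact hsc_cont.comp hmap fun p hp => ⟨Set.mem_univ _, (hparam p.1 hp.1 p.2 hp.2).le⟩
  have hstart : ∀ u : W,
      sc u ((1 - (0:ℝ)) * (I u ^ (-1/s)) + 0) = sc u (I u ^ (-1/s)) := by
    intro u
    simp
  have hend : ∀ u : W, sc u ((1 - (1:ℝ)) * (I u ^ (-1/s)) + 1) = u := by
    intro u
    simp [hH3b]
  have hprojcont : ContinuousOn (fun u : W => sc u (I u ^ (-1/s))) {u : W | u ∉ D2} := by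
    have h := hhomot.comp (f := fun u : W => (u, (0:ℝ))) (s := {u : W | u ∉ D2})
      (by fun_prop) fun u hu => ⟨hu, Set.left_mem_Icc.2 zero_le_one⟩
    exact h.congr fun u _ => (hstart u).symm
  have hmem : ∀ u : W, u ∉ D2 → ∀ τ ∈ Set.Icc (0:ℝ) 1,
      sc u ((1 - τ) * (I u ^ (-1/s)) + τ) ∉ D2 := fun u hu τ hτ =>
    hscale u _ hu (hparam u hu τ hτ)
  refine ⟨hsphere, hproj, hprojcont, hfix, hmem, hhomot, fun u _ => hstart u,
    fun u _ => hend u, ?_⟩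
  let proj : C({u : W // u ∉ D2}, {u : W // I u = 1 ∧ u ∉ B0}) :=
    ⟨fun x => ⟨sc x (I x ^ (-1/s)), hproj x x.2⟩,
      (hprojcont.comp_continuous continuous_subtype_val fun x => x.2).subtype_mk _⟩
  let incl : C({u : W // I u = 1 ∧ u ∉ B0}, {u : W // u ∉ D2}) :=
    ⟨fun y => ⟨y, hsphere y y.2.1 y.2.2⟩, continuous_subtype_val.subtype_mk _⟩
  let homotopy : (incl.comp proj).Homotopy (ContinuousMap.id _) :=
    { toFun := fun p => ⟨sc p.2 ((1 - (p.1 : ℝ)) * (I p.2 ^ (-1/s)) + p.1),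
        hmem p.2 p.2.2 p.1 p.1.2⟩
      continuous_toFun :=
        (hhomot.comp_continuous (f := fun p : unitInterval × {u : W // u ∉ D2} =>
          ((p.2 : W), (p.1 : ℝ))) (by fun_prop) fun p => ⟨p.2.2, p.1.2⟩).subtype_mk _
      map_zero_left := fun x => Subtype.ext (hstart x)
      map_one_left := fun x => Subtype.ext (hend x) }
  have hright : proj.comp incl = ContinuousMap.id _ :=
    ContinuousMap.ext fun y => Subtype.ext (hfix y y.2.1 y.2.2)
  exact ⟨⟨proj, incl, ⟨homotopy⟩, hright ▸ ContinuousMap.Homotopic.refl _⟩,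
    fun _ => rfl, fun _ => rfl⟩
end

section
/- Let W be a real normed vector space equipped with a continuous map W × [0,∞) → W, (u,t) ↦ u_t, satisfying (H1) (u_{t1})_{t2} = u_{t1·t2} for all u ∈ W and t1, t2 ≥ 0, and (H3) u_0 = 0 and u_1 = u for all u ∈ W. Let s > 0 and let I : W → ℝ be continuous with I(0) = 0, I(u) > 0 for every u ≠ 0, and I(u_t) = t^s·I(u) for all u ∈ W and t ≥ 0. Set M = {u ∈ W : I(u) = 1}. Then the map H : (W ∖ {0}) × [0,1] → W ∖ {0}, H(u,τ) = u_{(1−τ) + τ·I(u)^{−1/s}}, is well defined (H(u,τ) ≠ 0) and continuous, and satisfies H(u,0) = u and H(u,1) ∈ M for all u ∈ W ∖ {0}, and H(u,τ) = u for all u ∈ M and τ ∈ [0,1]. In particular, M is a strong deformation retract of W ∖ {0}. -/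
/-- M is a strong deformation retract of W \ {0} via
H(u,τ) = u_{(1-τ) + τ I(u)^{-1/s}}. -/
theorem stmt_8 {W : Type*} [NormedAddCommGroup W] [NormedSpace ℝ W]
    (sc : W → ℝ → W)
    (hsc_cont : ContinuousOn (fun p : W × ℝ => sc p.1 p.2) (Set.univ ×ˢ Set.Ici (0:ℝ)))
    (hH1 : ∀ (u : W) (t1 t2 : ℝ), 0 ≤ t1 → 0 ≤ t2 → sc (sc u t1) t2 = sc u (t1 * t2))
    (hH3a : ∀ u : W, sc u 0 = 0) (hH3b : ∀ u : W, sc u 1 = u)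
    (s : ℝ) (hs : 0 < s)
    (I : W → ℝ) (hIcont : Continuous I) (hI0 : I 0 = 0)
    (hIpos : ∀ u : W, u ≠ 0 → 0 < I u)
    (hIscale : ∀ (u : W) (t : ℝ), 0 ≤ t → I (sc u t) = t ^ s * I u) :
    -- H is well defined: it maps (W \ {0}) × [0,1] into W \ {0}
    (∀ u : W, u ≠ 0 → ∀ τ ∈ Set.Icc (0:ℝ) 1,
      sc u ((1 - τ) + τ * (I u ^ (-1/s))) ≠ 0) ∧
    -- H is continuous
    ContinuousOn (fun p : W × ℝ => sc p.1 ((1 - p.2) + p.2 * (I p.1 ^ (-1/s))))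
      ({u : W | u ≠ 0} ×ˢ Set.Icc (0:ℝ) 1) ∧
    -- H(u,0) = u
    (∀ u : W, u ≠ 0 → sc u ((1 - (0:ℝ)) + 0 * (I u ^ (-1/s))) = u) ∧
    -- H(u,1) ∈ M
    (∀ u : W, u ≠ 0 → I (sc u ((1 - (1:ℝ)) + 1 * (I u ^ (-1/s)))) = 1) ∧
    -- H fixes M
    (∀ u : W, I u = 1 → ∀ τ ∈ Set.Icc (0:ℝ) 1,
      sc u ((1 - τ) + τ * (I u ^ (-1/s))) = u) := by
  have hpos : ∀ u : W, u ≠ 0 → ∀ τ ∈ Set.Icc (0 : ℝ) 1,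
      0 < (1 - τ) + τ * (I u ^ (-1/s)) := by
    rintro u hu τ ⟨h0, h1⟩
    have hc : 0 < I u ^ (-1/s) := Real.rpow_pos_of_pos (hIpos u hu) _
    rcases h0.eq_or_lt with rfl | h0
    · simp
    · have := mul_pos h0 hc
      linarith
  refine ⟨?_, ?_, ?_, ?_, ?_⟩
  · intro u hu τ hτ h
    have ht := hpos u hu τ hτ
    have hI := hIscale u _ ht.le
    rw [h, hI0] at hI
    exact (mul_pos (Real.rpow_pos_of_pos ht s) (hIpos u hu)).ne hI
  · have hpow : ContinuousOn (fun p : W × ℝ => I p.1 ^ (-1/s))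
        ({u : W | u ≠ 0} ×ˢ Set.Icc (0 : ℝ) 1) :=
      (hIcont.comp continuous_fst).continuousOn.rpow_const
        fun p hp => Or.inl (hIpos p.1 hp.1).ne'
    have hpair : ContinuousOn (fun p : W × ℝ => (p.1, (1 - p.2) + p.2 * (I p.1 ^ (-1/s))))
        ({u : W | u ≠ 0} ×ˢ Set.Icc (0 : ℝ) 1) :=
      continuousOn_fst.prodMk
        ((continuousOn_const.sub continuousOn_snd).add (continuousOn_snd.mul hpow))
    exact hsc_cont.comp hpair fun p hp => ⟨Set.mem_univ _, (hpos p.1 hp.1 p.2 hp.2).le⟩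
  · intro u _
    simpa using hH3b u
  · intro u hu
    have hu' := hIpos u hu
    rw [hIscale u _ (hpos u hu 1 (by simp)).le, sub_self, zero_add, one_mul,
      ← Real.rpow_mul hu'.le, div_mul_cancel₀ _ hs.ne', Real.rpow_neg_one,
      inv_mul_cancel₀ hu'.ne']
  · intro u hu τ _
    simpa [hu] using hH3b u
end

section
/- Let W be a real normed vector space equipped with a continuous map W × [0,∞) → W, (u,t) ↦ u_t, satisfying (H1) (u_{t1})_{t2} = u_{t1·t2} for all u ∈ W and t1, t2 ≥ 0, and (H3) u_0 = 0 and u_1 = u for all u ∈ W. Let s > 0 and let I : W → ℝ be continuous, even, coercive (I(u) → ∞ as ‖u‖ → ∞), with I(0) = 0, I(u) > 0 for u ≠ 0, I(u_t) = t^s·I(u) for all u, t, and such that for every u ≠ 0 the map t ↦ I(t·u) is strictly increasing on (0,∞). Set M = {u ∈ W : I(u) = 1} and let π_rad(u) = t(u)·u, where t(u) > 0 is the unique positive real with I(t(u)·u) = 1. Let A_0 ⊆ M be nonempty and symmetric (A_0 = −A_0), let w̃ ∈ M ∖ A_0, and set A_1 = {π_rad((1−τ)·v + τ·w̃) : v ∈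 A_0, 0 ≤ τ ≤ 1}. Then A_1 is well defined and, with the subspace topology, A_1 is contractible; in fact (u,t) ↦ π_rad((1−t)·u + t·w̃) is a well-defined continuous contraction of A_1 to w̃. -/
open Set

section RadialProjection

variable {W : Type*} [NormedAddCommGroup W] [NormedSpace ℝ W] {I : W → ℝ} {T : W → ℝ}

/-- Along a ray on which `I` is strictly increasing, a level of `I` is attained at most once. -/
theorem eq_of_level_eq_on_ray {u : W}
    (hmono : StrictMonoOn (fun t : ℝ => I (t • u)) (Ioi (0 : ℝ))) {a b : ℝ}
    (ha : 0 < a) (hb : 0 < b) (hab : I (a • u) = I (b • u)) : a = b :=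
  hmono.injOn ha hb hab

/-- Radial projection is invariant under positive scaling. -/
theorem radialProj_smul
    (hmono : ∀ u : W, u ≠ 0 → StrictMonoOn (fun t : ℝ => I (t • u)) (Ioi (0 : ℝ)))
    (hT : ∀ u : W, u ≠ 0 → 0 < T u ∧ I (T u • u) = 1) {u : W} (hu : u ≠ 0) {c : ℝ}
    (hc : 0 < c) : T (c • u) • c • u = T u • u := by
  obtain ⟨h1, h2⟩ := hT u hu
  obtain ⟨h3, h4⟩ := hT (c • u) (smul_ne_zero hc.ne' hu)
  rw [smul_smul] at h4 ⊢
  rw [eq_of_level_eq_on_ray (hmono u hu) (mul_pos h3 hc) h1 (h4.trans h2.symm)]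

/-- Radial projection fixes the level set `I = 1`. -/
theorem radialProj_of_level_one
    (hmono : ∀ u : W, u ≠ 0 → StrictMonoOn (fun t : ℝ => I (t • u)) (Ioi (0 : ℝ)))
    (hT : ∀ u : W, u ≠ 0 → 0 < T u ∧ I (T u • u) = 1) {u : W} (hu : u ≠ 0) (hI : I u = 1) :
    T u • u = u := by
  obtain ⟨h1, h2⟩ := hT u hu
  rw [eq_of_level_eq_on_ray (hmono u hu) h1 one_pos (by rw [h2, one_smul, hI]), one_smul]

/-- The radial scaling factor is continuous away from the origin. -/
theorem continuousAt_radialFactor (hI : Continuous I)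
    (hmono : ∀ u : W, u ≠ 0 → StrictMonoOn (fun t : ℝ => I (t • u)) (Ioi (0 : ℝ)))
    (hT : ∀ u : W, u ≠ 0 → 0 < T u ∧ I (T u • u) = 1) {u : W} (hu : u ≠ 0) :
    ContinuousAt T u := by
  obtain ⟨h1, h2⟩ := hT u hu
  have hcont (a : ℝ) : Continuous fun x : W => I (a • x) := by fun_prop
  refine tendsto_order.2 ⟨fun a ha => ?_, fun b hb => ?_⟩
  · rcases le_or_gt a 0 with ha0 | ha0
    · filter_upwards [eventually_ne_nhds hu] with x hx using ha0.trans_lt (hT x hx).1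
    · have hlt : I (a • u) < 1 := h2 ▸ hmono u hu ha0 h1 ha
      filter_upwards [eventually_ne_nhds hu, (hcont a).continuousAt.eventually_lt_const hlt]
        with x hx hxa
      by_contra! hle
      have := (hmono x hx).monotoneOn (hT x hx).1 ha0 hle
      simp only [(hT x hx).2] at this
      exact this.not_gt hxa
  · have hb0 : 0 < b := h1.trans hb
    have hlt : 1 < I (b • u) := h2 ▸ hmono u hu h1 hb0 hb
    filter_upwards [eventually_ne_nhds hu, (hcont b).continuousAt.eventually_const_lt hlt]
      with x hx hxb
    by_contra! hle
    have := (hmono x hx).monotoneOn hb0 (hT x hx).1 hle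
    simp only [(hT x hx).2] at this
    exact this.not_gt hxb

/-- The segment joining two points of the level set `I = 1` that are not antipodal avoids `0`. -/
theorem segment_ne_zero
    (hmono : ∀ u : W, u ≠ 0 → StrictMonoOn (fun t : ℝ => I (t • u)) (Ioi (0 : ℝ)))
    (heven : ∀ u : W, I (-u) = I u) (hI0 : I 0 = 0) {v w : W} (hv : I v = 1) (hw : I w = 1)
    (hvw : w ≠ -v) {τ : ℝ} (hτ : τ ∈ Icc (0 : ℝ) 1) : (1 - τ) • v + τ • w ≠ 0 := by
  intro h
  have hv0 : v ≠ 0 := by rintro rfl; simp [hI0] at hv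
  have hw0 : w ≠ 0 := by rintro rfl; simp [hI0] at hw
  rcases hτ.1.eq_or_lt with rfl | h0
  · simp [hv0] at h
  rcases hτ.2.eq_or_lt with rfl | h1
  · simp [hw0] at h
  have hwv : w = ((1 - τ) / τ) • (-v) := by
    have h' : τ • w = (1 - τ) • (-v) := by
      rw [smul_neg]; exact eq_neg_of_add_eq_zero_right h
    rw [div_eq_inv_mul, mul_smul, ← h', inv_smul_smul₀ h0.ne']
  have hone : (1 - τ) / τ = 1 :=
    eq_of_level_eq_on_ray (hmono (-v) (neg_ne_zero.2 hv0)) (div_pos (by linarith) h0) one_pos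
      (by rw [← hwv, hw, one_smul, heven, hv])
  exact hvw (by rw [hwv, hone, one_smul])

end RadialProjection

/-- A subset is contractible if some homotopy on it deforms the identity to a constant. -/
theorem contractibleSpace_of_continuousOn {X : Type*} [TopologicalSpace X] {A : Set X}
    {F : X × ℝ → X} (hF : ContinuousOn F (A ×ˢ Icc (0 : ℝ) 1))
    (hmem : ∀ x ∈ A, ∀ t ∈ Icc (0 : ℝ) 1, F (x, t) ∈ A) (h0 : ∀ x ∈ A, F (x, 0) = x)
    {y : X} (hy : y ∈ A) (h1 : ∀ x ∈ A, F (x, 1) = y) : ContractibleSpace A := by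
  rw [contractible_iff_id_nullhomotopic]
  refine ⟨⟨y, hy⟩, ⟨⟨⟨fun p => ⟨F (p.2, p.1), hmem _ p.2.2 _ p.1.2⟩, ?_⟩, ?_, ?_⟩⟩⟩
  · refine Continuous.subtype_mk (hF.comp_continuous (by fun_prop) fun p => ?_) _
    exact ⟨p.2.2, p.1.2⟩
  · exact fun x => Subtype.ext (h0 x x.2)
  · exact fun x => Subtype.ext (h1 x x.2)


/-- A₁ is well defined and contractible, via the contraction
(u,t) ↦ π_rad((1-t)u + t w̃) to w̃. -/
theorem stmt_9 {W : Type*} [NormedAddCommGroup W] [NormedSpace ℝ W]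
    (sc : W → ℝ → W)
    (hsc_cont : ContinuousOn (fun p : W × ℝ => sc p.1 p.2) (Set.univ ×ˢ Set.Ici (0:ℝ)))
    (hH1 : ∀ (u : W) (t1 t2 : ℝ), 0 ≤ t1 → 0 ≤ t2 → sc (sc u t1) t2 = sc u (t1 * t2))
    (hH3a : ∀ u : W, sc u 0 = 0) (hH3b : ∀ u : W, sc u 1 = u)
    (s : ℝ) (hs : 0 < s)
    (I : W → ℝ) (hIcont : Continuous I) (hIeven : ∀ u : W, I (-u) = I u)
    (hIcoercive : ∀ c : ℝ, ∃ R : ℝ, ∀ u : W, R ≤ ‖u‖ → c ≤ I u)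
    (hI0 : I 0 = 0) (hIpos : ∀ u : W, u ≠ 0 → 0 < I u)
    (hIscale : ∀ (u : W) (t : ℝ), 0 ≤ t → I (sc u t) = t ^ s * I u)
    (hImono : ∀ u : W, u ≠ 0 → StrictMonoOn (fun t : ℝ => I (t • u)) (Set.Ioi (0:ℝ)))
    -- the radial projection π_rad(u) = T(u) • u, T(u) the unique positive real
    -- with I(T(u) • u) = 1
    (T : W → ℝ) (hT : ∀ u : W, u ≠ 0 → 0 < T u ∧ I (T u • u) = 1)
    (A0 : Set W) (hA0M : A0 ⊆ {u : W | I u = 1}) (hA0ne : A0.Nonempty)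
    (hA0sym : ∀ u ∈ A0, -u ∈ A0)
    (w : W) (hwM : I w = 1) (hw : w ∉ A0)
    (A1 : Set W)
    (hA1 : A1 = {x : W | ∃ v ∈ A0, ∃ τ ∈ Set.Icc (0:ℝ) 1,
      x = T ((1-τ) • v + τ • w) • ((1-τ) • v + τ • w)}) :
    -- A₁ is well defined
    (∀ v ∈ A0, ∀ τ ∈ Set.Icc (0:ℝ) 1, (1-τ) • v + τ • w ≠ 0) ∧
    -- the contraction is well defined and maps A₁ × [0,1] into A₁
    (∀ u ∈ A1, ∀ t ∈ Set.Icc (0:ℝ) 1, (1-t) • u + t • w ≠ 0 ∧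
      T ((1-t) • u + t • w) • ((1-t) • u + t • w) ∈ A1) ∧
    -- it is continuous
    ContinuousOn (fun p : W × ℝ =>
        T ((1-p.2) • p.1 + p.2 • w) • ((1-p.2) • p.1 + p.2 • w))
      (A1 ×ˢ Set.Icc (0:ℝ) 1) ∧
    -- it starts at the identity of A₁ and ends at the constant w̃
    (∀ u ∈ A1, T ((1-(0:ℝ)) • u + (0:ℝ) • w) • ((1-(0:ℝ)) • u + (0:ℝ) • w) = u) ∧
    (∀ u ∈ A1, T ((1-(1:ℝ)) • u + (1:ℝ) • w) • ((1-(1:ℝ)) • u + (1:ℝ) • w) = w) ∧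
    -- hence A₁ is contractible
    ContractibleSpace ↥A1 := by
  have hne : ∀ x : W, I x = 1 → x ≠ 0 := by
    rintro x hx rfl
    simp [hI0] at hx
  have hseg : ∀ v ∈ A0, ∀ τ ∈ Icc (0 : ℝ) 1, (1 - τ) • v + τ • w ≠ 0 := fun v hv τ hτ =>
    segment_ne_zero hImono hIeven hI0 (hA0M hv) hwM (fun h => hw (h ▸ hA0sym v hv)) hτ
  have hA1M : ∀ u ∈ A1, I u = 1 := by
    rw [hA1]
    rintro _ ⟨v, hv, τ, hτ, rfl⟩
    exact (hT _ (hseg v hv τ hτ)).2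
  have hmem : ∀ u ∈ A1, ∀ t ∈ Icc (0 : ℝ) 1, (1 - t) • u + t • w ≠ 0 ∧
      T ((1 - t) • u + t • w) • ((1 - t) • u + t • w) ∈ A1 := by
    rw [hA1]
    rintro _ ⟨v, hv, τ, hτ, rfl⟩ t ht
    have hc := (hT _ (hseg v hv τ hτ)).1
    set c := T ((1 - τ) • v + τ • w)
    have hpos : 0 < (1 - t) * c + t := by
      rcases ht.1.eq_or_lt with rfl | h
      · simpa using hc
      · have := mul_nonneg (sub_nonneg.2 ht.2) hc.le
        linarith
    have hσ : ((1 - t) * c * τ + t) / ((1 - t) * c + t) ∈ Icc (0 : ℝ) 1 := by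
      have h1 := mul_nonneg (sub_nonneg.2 ht.2) hc.le
      refine ⟨div_nonneg (add_nonneg (mul_nonneg h1 hτ.1) ht.1) hpos.le, ?_⟩
      rw [div_le_one hpos]
      have := mul_le_of_le_one_right h1 hτ.2
      linarith
    set σ := ((1 - t) * c * τ + t) / ((1 - t) * c + t) with hσdef
    have hmul : ((1 - t) * c + t) * σ = (1 - t) * c * τ + t := mul_div_cancel₀ _ hpos.ne'
    have heq : (1 - t) • c • ((1 - τ) • v + τ • w) + t • w
        = ((1 - t) * c + t) • ((1 - σ) • v + σ • w) := by
      rw [smul_add _ ((1 - σ) • v), smul_smul _ σ, hmul, smul_smul _ (1 - σ), mul_sub, hmul]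
      module
    rw [heq]
    have hx := hseg v hv σ hσ
    exact ⟨smul_ne_zero hpos.ne' hx, v, hv, σ, hσ, radialProj_smul hImono hT hx hpos⟩
  have hcont : ContinuousOn (fun p : W × ℝ =>
      T ((1 - p.2) • p.1 + p.2 • w) • ((1 - p.2) • p.1 + p.2 • w)) (A1 ×ˢ Icc (0 : ℝ) 1) := by
    have hline : Continuous fun p : W × ℝ => (1 - p.2) • p.1 + p.2 • w := by fun_prop
    intro p hp
    have hTp := continuousAt_radialFactor hIcont hImono hT (hmem p.1 hp.1 p.2 hp.2).1
    exact ((ContinuousAt.comp (f := fun p : W × ℝ => (1 - p.2) • p.1 + p.2 • w) hTp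
      hline.continuousAt).smul hline.continuousAt).continuousWithinAt
  have hstart : ∀ u ∈ A1,
      T ((1 - (0 : ℝ)) • u + (0 : ℝ) • w) • ((1 - (0 : ℝ)) • u + (0 : ℝ) • w) = u := by
    intro u hu
    simpa using radialProj_of_level_one hImono hT (hne u (hA1M u hu)) (hA1M u hu)
  have hend : ∀ u ∈ A1,
      T ((1 - (1 : ℝ)) • u + (1 : ℝ) • w) • ((1 - (1 : ℝ)) • u + (1 : ℝ) • w) = w := by
    intro u _
    simpa using radialProj_of_level_one hImono hT (hne w hwM) hwM
  have hwA1 : w ∈ A1 := by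
    obtain ⟨v, hv⟩ := hA0ne
    rw [hA1]
    refine ⟨v, hv, 1, ⟨zero_le_one, le_rfl⟩, ?_⟩
    simpa using (radialProj_of_level_one hImono hT (hne w hwM) hwM).symm
  exact ⟨hseg, hmem, hcont, hstart, hend,
    contractibleSpace_of_continuousOn hcont (fun u hu t ht => (hmem u hu t ht).2) hstart hwA1 hend⟩
end

section
/- Let W be a real normed vector space equipped with a continuous map W × [0,∞) → W, (u,t) ↦ u_t, satisfying (H1) (u_{t1})_{t2} = u_{t1·t2} for all u ∈ W and t1, t2 ≥ 0, and (H3) u_0 = 0 and u_1 = u for all u ∈ W. Let s > 0 and let I : W → ℝ be continuous, even, coercive, with I(0) = 0, I(u) > 0 for u ≠ 0, I(u_t) = t^s·I(u) for all u, t, and such that for every u ≠ 0 the map t ↦ I(t·u) is strictly increasing on (0,∞). Set M = {u ∈ W : I(u) = 1}, let π_rad be the radial projection onto M, let A_0 ⊆ M be nonempty and symmetric, w̃ ∈ M ∖ A_0, A_1 = {π_rad((1−τ)·v + τ·w̃) : v ∈ A_0, 0 ≤ τ ≤ 1}, and let 0 ≤ r < R. Then the set A_2 = {u_r : u ∈ A_1}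 ∪ {v_t : v ∈ A_0, r ≤ t ≤ R}, with the subspace topology, is contractible; moreover, if r > 0 then the map (u,t) ↦ u_{(1−t) + r·t·I(u)^{−1/s}} is a strong deformation retraction of A_2 onto {u_r : u ∈ A_1}. -/
/-- A jointly continuous deformation of `A` inside itself is a homotopy from the identity of `A`. -/
theorem homotopic_id_of_deformation {X : Type*} [TopologicalSpace X] {A : Set X}
    (H : X → ℝ → X) (hc : ContinuousOn (fun p : X × ℝ => H p.1 p.2) (A ×ˢ Set.Icc (0:ℝ) 1))
    (hmaps : ∀ x ∈ A, ∀ t ∈ Set.Icc (0:ℝ) 1, H x t ∈ A) (h0 : ∀ x ∈ A, H x 0 = x)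
    (f : C(A, A)) (h1 : ∀ x : A, H x 1 = f x) :
    (ContinuousMap.id A).Homotopic f := by
  refine ⟨{ toFun := fun p => ⟨H p.2 p.1, hmaps _ p.2.2 _ p.1.2⟩
            continuous_toFun := ?_, map_zero_left := ?_, map_one_left := ?_ }⟩
  · refine Continuous.subtype_mk ?_ _
    exact hc.comp_continuous (f := fun p : unitInterval × A => ((p.2 : X), (p.1 : ℝ)))
      (by fun_prop) (fun p => ⟨p.2.2, p.1.2⟩)
  · intro x
    exact Subtype.ext (h0 x x.2)
  · intro x
    exact Subtype.ext (h1 x)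

/-- A set that deforms inside itself to one of its points is contractible. -/
theorem contractibleSpace_of_deformation {X : Type*} [TopologicalSpace X] {A : Set X}
    (H : X → ℝ → X) (hc : ContinuousOn (fun p : X × ℝ => H p.1 p.2) (A ×ˢ Set.Icc (0:ℝ) 1))
    (hmaps : ∀ x ∈ A, ∀ t ∈ Set.Icc (0:ℝ) 1, H x t ∈ A) (h0 : ∀ x ∈ A, H x 0 = x)
    {c : X} (hcA : c ∈ A) (h1 : ∀ x ∈ A, H x 1 = c) :
    ContractibleSpace A :=
  (contractible_iff_id_nullhomotopic A).2
    ⟨⟨c, hcA⟩, homotopic_id_of_deformation H hc hmaps h0 (ContinuousMap.const _ ⟨c, hcA⟩)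
      fun x => h1 x x.2⟩

section Radial

variable {W : Type*} [NormedAddCommGroup W] [NormedSpace ℝ W] {I : W → ℝ}

/-- The radius at which a ray meets the level set `I = 1` is unique. -/
theorem radius_unique
    (hImono : ∀ u : W, u ≠ 0 → StrictMonoOn (fun t : ℝ => I (t • u)) (Set.Ioi (0:ℝ)))
    {u : W} (hu : u ≠ 0) {a b : ℝ} (ha : 0 < a) (hb : 0 < b)
    (hab : I (a • u) = I (b • u)) : a = b :=
  (hImono u hu).injOn ha hb hab

/-- The radius at which rays meet the level set `I = 1` depends continuously on the direction. -/
theorem continuousOn_radius (hIcont : Continuous I)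
    (hImono : ∀ u : W, u ≠ 0 → StrictMonoOn (fun t : ℝ => I (t • u)) (Set.Ioi (0:ℝ)))
    {T : W → ℝ} (hT : ∀ u : W, u ≠ 0 → 0 < T u ∧ I (T u • u) = 1) :
    ContinuousOn T {u : W | u ≠ 0} := by
  intro u hu
  have hTu := hT u hu
  have hne : ∀ᶠ x in nhds u, x ≠ 0 := isOpen_ne.mem_nhds hu
  refine ContinuousAt.continuousWithinAt ?_
  refine tendsto_order.2 ⟨fun a ha => ?_, fun b hb => ?_⟩
  · rcases le_or_gt a 0 with ha0 | ha0
    · filter_upwards [hne] with x hx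
      exact ha0.trans_lt (hT x hx).1
    · have hlt : I (a • u) < 1 := by
        rw [← hTu.2]; exact hImono u hu ha0 hTu.1 ha
      have hev : ∀ᶠ x in nhds u, I (a • x) < 1 :=
        (hIcont.comp (continuous_const_smul a)).continuousAt.eventually_lt
          continuousAt_const hlt
      filter_upwards [hne, hev] with x hx hxa
      rw [← (hT x hx).2] at hxa
      exact ((hImono x hx).lt_iff_lt ha0 (hT x hx).1).1 hxa
  · have hb0 : 0 < b := hTu.1.trans hb
    have hlt : 1 < I (b • u) := by
      rw [← hTu.2]; exact hImono u hu hTu.1 hb0 hb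
    have hev : ∀ᶠ x in nhds u, 1 < I (b • x) :=
      continuousAt_const.eventually_lt
        (hIcont.comp (continuous_const_smul b)).continuousAt hlt
    filter_upwards [hne, hev] with x hx hxb
    rw [← (hT x hx).2] at hxb
    exact ((hImono x hx).lt_iff_lt (hT x hx).1 hb0).1 hxb

/-- The radial projection is invariant under positive rescaling. -/
theorem radial_smul
    (hImono : ∀ u : W, u ≠ 0 → StrictMonoOn (fun t : ℝ => I (t • u)) (Set.Ioi (0:ℝ)))
    {T : W → ℝ} (hT : ∀ u : W, u ≠ 0 → 0 < T u ∧ I (T u • u) = 1)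
    {u : W} (hu : u ≠ 0) {c : ℝ} (hc : 0 < c) :
    T (c • u) • (c • u) = T u • u := by
  have hcu : c • u ≠ 0 := smul_ne_zero hc.ne' hu
  rw [smul_smul]
  congr 1
  refine radius_unique hImono hu (mul_pos (hT _ hcu).1 hc) (hT u hu).1 ?_
  rw [← smul_smul, (hT _ hcu).2, (hT u hu).2]

/-- The radial projection fixes the level set `I = 1`. -/
theorem radial_of_mem
    (hImono : ∀ u : W, u ≠ 0 → StrictMonoOn (fun t : ℝ => I (t • u)) (Set.Ioi (0:ℝ)))
    {T : W → ℝ} (hT : ∀ u : W, u ≠ 0 → 0 < T u ∧ I (T u • u) = 1)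
    {u : W} (hu : u ≠ 0) (h1 : I u = 1) : T u • u = u := by
  have h : T u = 1 := radius_unique hImono hu (hT u hu).1 one_pos (by
    rw [(hT u hu).2, one_smul, h1])
  rw [h, one_smul]

/-- Two points of the level set `I = 1` that are not antipodal do not have `0` as a nonnegative
combination. -/
theorem combination_ne_zero (hI0 : I 0 = 0) (hIeven : ∀ u : W, I (-u) = I u)
    (hImono : ∀ u : W, u ≠ 0 → StrictMonoOn (fun t : ℝ => I (t • u)) (Set.Ioi (0:ℝ)))
    {v w : W} (hv : I v = 1) (hw : I w = 1) (hvw : w ≠ -v)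
    {a b : ℝ} (ha : 0 ≤ a) (hb : 0 ≤ b) (hab : 0 < a + b) :
    a • v + b • w ≠ 0 := by
  intro h
  have hne : ∀ {x : W}, I x = 1 → x ≠ 0 := by
    rintro x hx rfl
    exact zero_ne_one (hI0.symm.trans hx)
  rcases ha.eq_or_lt with rfl | ha
  · have hb' : b ≠ 0 := by linarith
    simp [hb', hne hw] at h
  rcases hb.eq_or_lt with rfl | hb
  · simp [ha.ne', hne hv] at h
  have heq : b • w = -(a • v) := eq_neg_of_add_eq_zero_right h
  have hwv : w = -((b⁻¹ * a) • v) := by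
    rw [← smul_smul, ← smul_neg, ← heq, smul_smul, inv_mul_cancel₀ hb.ne', one_smul]
  have h1 : b⁻¹ * a = 1 := radius_unique hImono (hne hv) (by positivity) one_pos (by
    rw [one_smul, hv, ← hw, hwv, hIeven])
  rw [h1, one_smul] at hwv
  exact hvw hwv

/-- The radial join of a subset of the level set `I = 1` with a point of that level set whose
antipode does not lie in the subset is contractible. -/
theorem contractibleSpace_radialJoin (hIcont : Continuous I) (hI0 : I 0 = 0)
    (hIeven : ∀ u : W, I (-u) = I u)
    (hImono : ∀ u : W, u ≠ 0 → StrictMonoOn (fun t : ℝ => I (t • u)) (Set.Ioi (0:ℝ)))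
    {T : W → ℝ} (hT : ∀ u : W, u ≠ 0 → 0 < T u ∧ I (T u • u) = 1)
    {A : Set W} (hAM : A ⊆ {u : W | I u = 1}) (hAne : A.Nonempty)
    {w : W} (hwM : I w = 1) (hw : ∀ v ∈ A, w ≠ -v) :
    ContractibleSpace {x : W | ∃ v ∈ A, ∃ τ ∈ Set.Icc (0:ℝ) 1,
      x = T ((1-τ) • v + τ • w) • ((1-τ) • v + τ • w)} := by
  set J : Set W := {x : W | ∃ v ∈ A, ∃ τ ∈ Set.Icc (0:ℝ) 1,
    x = T ((1-τ) • v + τ • w) • ((1-τ) • v + τ • w)}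
  have hw0 : w ≠ 0 := by
    rintro rfl
    exact zero_ne_one (hI0.symm.trans hwM)
  have hcomb : ∀ {v : W}, v ∈ A → ∀ {a b : ℝ}, 0 ≤ a → 0 ≤ b → 0 < a + b →
      a • v + b • w ≠ 0 := fun hv _ _ ha hb hab =>
    combination_ne_zero hI0 hIeven hImono (hAM hv) hwM (hw _ hv) ha hb hab
  have hJ : ∀ {v : W}, v ∈ A → ∀ {a b : ℝ}, 0 ≤ a → 0 ≤ b → 0 < a + b →
      T (a • v + b • w) • (a • v + b • w) ∈ J := by
    intro v hv a b ha hb hab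
    refine ⟨v, hv, (a + b)⁻¹ * b, ⟨by positivity, ?_⟩, ?_⟩
    · rw [inv_mul_le_iff₀ hab]; linarith
    · have h : (1 - (a + b)⁻¹ * b) • v + ((a + b)⁻¹ * b) • w = (a + b)⁻¹ • (a • v + b • w) := by
        rw [smul_add, smul_smul, smul_smul]
        congr 2
        field_simp
        ring
      rw [h, radial_smul hImono hT (hcomb hv ha hb hab) (inv_pos.2 hab)]
  have hsegment : ∀ x ∈ J, ∀ σ ∈ Set.Icc (0:ℝ) 1, ∃ v ∈ A, ∃ a b : ℝ, 0 ≤ a ∧ 0 ≤ b ∧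
      0 < a + b ∧ (1 - σ) • x + σ • w = a • v + b • w := by
    rintro x ⟨v, hv, τ, ⟨hτ0, hτ1⟩, rfl⟩ σ ⟨hσ0, hσ1⟩
    have hc := (hT _ (hcomb hv (sub_nonneg.2 hτ1) hτ0 (by linarith))).1
    set c := T ((1-τ) • v + τ • w)
    have h1σ := sub_nonneg.2 hσ1
    have h1τ := sub_nonneg.2 hτ1
    refine ⟨v, hv, (1 - σ) * c * (1 - τ), (1 - σ) * c * τ + σ, by positivity, by positivity, ?_,
      by module⟩
    have h : (1 - σ) * c * (1 - τ) + ((1 - σ) * c * τ + σ) = (1 - σ) * c + σ := by ring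
    rw [h]
    rcases hσ0.eq_or_lt with rfl | hσ
    · simpa using hc
    · positivity
  have hJM : ∀ x ∈ J, x ≠ 0 ∧ I x = 1 := by
    rintro x ⟨v, hv, τ, ⟨hτ0, hτ1⟩, rfl⟩
    have hne := hcomb hv (sub_nonneg.2 hτ1) hτ0 (by linarith)
    exact ⟨smul_ne_zero (hT _ hne).1.ne' hne, (hT _ hne).2⟩
  refine contractibleSpace_of_deformation
    (fun x σ => T ((1 - σ) • x + σ • w) • ((1 - σ) • x + σ • w)) ?_ ?_ ?_ (c := w) ?_ ?_
  · have hline : Continuous fun p : W × ℝ => (1 - p.2) • p.1 + p.2 • w := by fun_prop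
    refine ContinuousOn.smul ?_ hline.continuousOn
    refine (continuousOn_radius hIcont hImono hT).comp hline.continuousOn ?_
    rintro ⟨x, σ⟩ ⟨hx, hσ⟩
    obtain ⟨v, hv, a, b, ha, hb, hab, h⟩ := hsegment x hx σ hσ
    simpa only [Set.mem_ofPred_eq, h] using hcomb hv ha hb hab
  · intro x hx σ hσ
    obtain ⟨v, hv, a, b, ha, hb, hab, h⟩ := hsegment x hx σ hσ
    simpa only [h] using hJ hv ha hb hab
  · intro x hx
    simpa using radial_of_mem hImono hT (hJM x hx).1 (hJM x hx).2
  · obtain ⟨v, hv⟩ := hAne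
    exact ⟨v, hv, 1, by simp, by simpa using (radial_of_mem hImono hT hw0 hwM).symm⟩
  · intro x _
    simpa using radial_of_mem hImono hT hw0 hwM

end Radial


/-- A₂ = {u_r : u ∈ A₁} ∪ {v_t : v ∈ A₀, r ≤ t ≤ R} is contractible;
for r > 0, (u,t) ↦ u_{(1-t) + r t I(u)^{-1/s}} is a strong deformation retraction of A₂
onto {u_r : u ∈ A₁}. -/
theorem stmt_10 {W : Type*} [NormedAddCommGroup W] [NormedSpace ℝ W]
    (sc : W → ℝ → W)
    (hsc_cont : ContinuousOn (fun p : W × ℝ => sc p.1 p.2) (Set.univ ×ˢ Set.Ici (0:ℝ)))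
    (hH1 : ∀ (u : W) (t1 t2 : ℝ), 0 ≤ t1 → 0 ≤ t2 → sc (sc u t1) t2 = sc u (t1 * t2))
    (hH3a : ∀ u : W, sc u 0 = 0) (hH3b : ∀ u : W, sc u 1 = u)
    (s : ℝ) (hs : 0 < s)
    (I : W → ℝ) (hIcont : Continuous I) (hIeven : ∀ u : W, I (-u) = I u)
    (hIcoercive : ∀ c : ℝ, ∃ R : ℝ, ∀ u : W, R ≤ ‖u‖ → c ≤ I u)
    (hI0 : I 0 = 0) (hIpos : ∀ u : W, u ≠ 0 → 0 < I u)
    (hIscale : ∀ (u : W) (t : ℝ), 0 ≤ t → I (sc u t) = t ^ s * I u)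
    (hImono : ∀ u : W, u ≠ 0 → StrictMonoOn (fun t : ℝ => I (t • u)) (Set.Ioi (0:ℝ)))
    (T : W → ℝ) (hT : ∀ u : W, u ≠ 0 → 0 < T u ∧ I (T u • u) = 1)
    (A0 : Set W) (hA0M : A0 ⊆ {u : W | I u = 1}) (hA0ne : A0.Nonempty)
    (hA0sym : ∀ u ∈ A0, -u ∈ A0)
    (w : W) (hwM : I w = 1) (hw : w ∉ A0)
    (A1 : Set W)
    (hA1 : A1 = {x : W | ∃ v ∈ A0, ∃ τ ∈ Set.Icc (0:ℝ) 1,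
      x = T ((1-τ) • v + τ • w) • ((1-τ) • v + τ • w)})
    (r R : ℝ) (hr : 0 ≤ r) (hrR : r < R)
    (A2 : Set W)
    (hA2 : A2 = {x : W | ∃ u ∈ A1, x = sc u r} ∪
      {x : W | ∃ v ∈ A0, ∃ t : ℝ, r ≤ t ∧ t ≤ R ∧ x = sc v t}) :
    -- A₂ is contractible
    ContractibleSpace ↥A2 ∧
    -- for r > 0, the explicit strong deformation retraction onto {u_r : u ∈ A₁}
    (0 < r →
      (∀ u ∈ A2, ∀ t ∈ Set.Icc (0:ℝ) 1,
        sc u ((1 - t) + r * t * (I u ^ (-1/s))) ∈ A2) ∧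
      ContinuousOn (fun p : W × ℝ => sc p.1 ((1 - p.2) + r * p.2 * (I p.1 ^ (-1/s))))
        (A2 ×ˢ Set.Icc (0:ℝ) 1) ∧
      (∀ u ∈ A2, sc u ((1 - (0:ℝ)) + r * 0 * (I u ^ (-1/s))) = u) ∧
      (∀ u ∈ A2, sc u ((1 - (1:ℝ)) + r * 1 * (I u ^ (-1/s)))
        ∈ {x : W | ∃ v ∈ A1, x = sc v r}) ∧
      (∀ u ∈ {x : W | ∃ v ∈ A1, x = sc v r}, ∀ t ∈ Set.Icc (0:ℝ) 1,
        sc u ((1 - t) + r * t * (I u ^ (-1/s))) = u)) := by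
  have hpow : ∀ t : ℝ, 0 < t → (t ^ s) ^ (-1/s) = t⁻¹ := fun t ht => by
    rw [← Real.rpow_mul ht.le, mul_div_cancel₀ _ hs.ne', Real.rpow_neg_one]
  have hne : ∀ x : W, I x = 1 → x ≠ 0 := by
    rintro x hx rfl
    exact zero_ne_one (hI0.symm.trans hx)
  have hanti : ∀ v ∈ A0, w ≠ -v := fun v hv h => hw (h ▸ hA0sym v hv)
  have hA1M : ∀ u ∈ A1, I u = 1 := by
    rw [hA1]
    rintro x ⟨v, hv, τ, ⟨hτ0, hτ1⟩, rfl⟩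
    exact (hT _ (combination_ne_zero hI0 hIeven hImono (hA0M hv) hwM (hanti v hv)
      (sub_nonneg.2 hτ1) hτ0 (by linarith))).2
  have hA01 : A0 ⊆ A1 := by
    intro v hv
    rw [hA1]
    exact ⟨v, hv, 0, by simp, by
      simpa using (radial_of_mem hImono hT (hne v (hA0M hv)) (hA0M hv)).symm⟩
  have hA1c : ContractibleSpace A1 := by
    rw [hA1]
    exact contractibleSpace_radialJoin hIcont hI0 hIeven hImono hT hA0M hA0ne hwM hanti
  have hIcurve : ∀ u : W, I u = 1 → ∀ t : ℝ, 0 < t → I (sc u t) ^ (-1/s) = t⁻¹ := by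
    intro u hu t ht
    rw [hIscale u t ht.le, hu, mul_one, hpow t ht]
  -- Every point of `A2` lies on the curve of a point of `A1`, and moving towards parameter `r`
  -- along this curve stays in `A2`.
  have hcurve : ∀ x ∈ A2, ∃ u ∈ A1, ∃ t : ℝ, r ≤ t ∧ x = sc u t ∧
      ∀ t' : ℝ, r ≤ t' → t' ≤ t → sc u t' ∈ A2 := by
    rw [hA2]
    rintro x (⟨u, hu, rfl⟩ | ⟨v, hv, t, hrt, htR, rfl⟩)
    · refine ⟨u, hu, r, le_rfl, rfl, fun t' h1 h2 => ?_⟩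
      rw [le_antisymm h2 h1]
      exact Or.inl ⟨u, hu, rfl⟩
    · exact ⟨v, hA01 hv, t, hrt, rfl, fun t' h1 h2 => Or.inr ⟨v, hv, t', h1, h2.trans htR, rfl⟩⟩
  have hApos : 0 < r → ∀ x ∈ A2, 0 < I x := by
    intro hr0 x hx
    obtain ⟨u, hu, t, ht, rfl, -⟩ := hcurve x hx
    rw [hIscale u t (hr.trans ht), hA1M u hu, mul_one]
    exact Real.rpow_pos_of_pos (hr0.trans_le ht) s
  have hdef : 0 < r →
      (∀ u ∈ A2, ∀ t ∈ Set.Icc (0:ℝ) 1,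
        sc u ((1 - t) + r * t * (I u ^ (-1/s))) ∈ A2) ∧
      ContinuousOn (fun p : W × ℝ => sc p.1 ((1 - p.2) + r * p.2 * (I p.1 ^ (-1/s))))
        (A2 ×ˢ Set.Icc (0:ℝ) 1) ∧
      (∀ u ∈ A2, sc u ((1 - (0:ℝ)) + r * 0 * (I u ^ (-1/s))) = u) ∧
      (∀ u ∈ A2, sc u ((1 - (1:ℝ)) + r * 1 * (I u ^ (-1/s)))
        ∈ {x : W | ∃ v ∈ A1, x = sc v r}) ∧
      (∀ u ∈ {x : W | ∃ v ∈ A1, x = sc v r}, ∀ t ∈ Set.Icc (0:ℝ) 1,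
        sc u ((1 - t) + r * t * (I u ^ (-1/s))) = u) := by
    intro hr0
    have hmove : ∀ u ∈ A1, ∀ t : ℝ, r ≤ t → ∀ τ ∈ Set.Icc (0:ℝ) 1,
        sc (sc u t) ((1 - τ) + r * τ * (I (sc u t) ^ (-1/s))) = sc u ((1 - τ) * t + τ * r) := by
      rintro u hu t ht τ ⟨h0, h1⟩
      have ht0 : 0 < t := hr0.trans_le ht
      have h1τ := sub_nonneg.2 h1
      rw [hIcurve u (hA1M u hu) t ht0, hH1 _ _ _ ht0.le (by positivity)]
      congr 1
      field_simp
    refine ⟨?_, ?_, ?_, ?_, ?_⟩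
    · intro x hx τ hτ
      obtain ⟨u, hu, t, ht, rfl, hA⟩ := hcurve x hx
      rw [hmove u hu t ht τ hτ]
      obtain ⟨h0, h1⟩ := hτ
      refine hA _ ?_ ?_
      · nlinarith
      · nlinarith
    · have hpc : ContinuousOn (fun p : W × ℝ => I p.1 ^ (-1/s)) (A2 ×ˢ Set.Icc (0:ℝ) 1) :=
        ContinuousOn.rpow_const (hIcont.comp continuous_fst).continuousOn
          fun p hp => Or.inl (hApos hr0 p.1 hp.1).ne'
      refine hsc_cont.comp (f := fun p : W × ℝ =>
        (p.1, (1 - p.2) + r * p.2 * (I p.1 ^ (-1/s)))) ?_ ?_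
      · exact continuousOn_fst.prodMk (ContinuousOn.add (by fun_prop)
          (ContinuousOn.mul (by fun_prop) hpc))
      · rintro ⟨x, τ⟩ ⟨hx, h0, h1⟩
        have h1τ := sub_nonneg.2 h1
        have := hApos hr0 x hx
        refine ⟨Set.mem_univ _, Set.mem_Ici.2 ?_⟩
        dsimp only at *
        positivity
    · intro x _
      simp [hH3b]
    · intro x hx
      obtain ⟨u, hu, t, ht, rfl, -⟩ := hcurve x hx
      refine ⟨u, hu, ?_⟩
      rw [hmove u hu t ht 1 (by simp)]
      simp
    · rintro x ⟨u, hu, rfl⟩ τ hτ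
      rw [hmove u hu r le_rfl τ hτ]
      congr 1
      ring
  refine ⟨?_, hdef⟩
  rcases hr.eq_or_lt with rfl | hr0
  · obtain ⟨v, hv⟩ := hA0ne
    refine contractibleSpace_of_deformation (fun x τ => sc x (1 - τ)) ?_ ?_ ?_ (c := 0) ?_ ?_
    · refine hsc_cont.comp (f := fun p : W × ℝ => (p.1, 1 - p.2)) (by fun_prop) ?_
      rintro ⟨x, τ⟩ ⟨-, -, h1⟩
      exact ⟨Set.mem_univ _, sub_nonneg.2 h1⟩
    · rintro x hx τ ⟨h0, h1⟩
      obtain ⟨u, hu, t, ht, rfl, hA⟩ := hcurve x hx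
      have h1τ := sub_nonneg.2 h1
      rw [hH1 _ _ _ ht h1τ]
      exact hA _ (by positivity) (by nlinarith)
    · intro x _
      simp [hH3b]
    · rw [hA2]
      exact Or.inl ⟨v, hA01 hv, (hH3a v).symm⟩
    · intro x _
      simp [hH3a]
  · obtain ⟨hmaps, hcont, h0, -, -⟩ := hdef hr0
    have hproj : ∀ u : W, I u = 1 → ∀ t : ℝ, 0 < t →
        sc (sc u t) (I (sc u t) ^ (-1/s)) = u := by
      intro u hu t ht
      rw [hIcurve u hu t ht, hH1 _ _ _ ht.le (by positivity), mul_inv_cancel₀ ht.ne', hH3b]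
    let ι : C(A1, A2) :=
      { toFun := fun u => ⟨sc u r, by rw [hA2]; exact Or.inl ⟨u, u.2, rfl⟩⟩
        continuous_toFun := by
          refine Continuous.subtype_mk ?_ _
          exact hsc_cont.comp_continuous (f := fun u : A1 => ((u : W), r)) (by fun_prop)
            fun u => ⟨Set.mem_univ _, hr⟩ }
    let ρ : C(A2, A1) :=
      { toFun := fun x => ⟨sc x (I x ^ (-1/s)), by
          obtain ⟨u, hu, t, ht, hx, -⟩ := hcurve x x.2
          rw [hx, hproj u (hA1M u hu) t (hr0.trans_le ht)]
          exact hu⟩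
        continuous_toFun := by
          refine Continuous.subtype_mk ?_ _
          exact hsc_cont.comp_continuous (f := fun x : A2 => ((x : W), I x ^ (-1/s)))
            (continuous_subtype_val.prodMk ((hIcont.comp continuous_subtype_val).rpow_const
              fun x => Or.inl (hApos hr0 x x.2).ne'))
            fun x => ⟨Set.mem_univ _, Real.rpow_nonneg (hApos hr0 x x.2).le _⟩ }
    have hιρ : (ContinuousMap.id A2).Homotopic (ι.comp ρ) := by
      refine homotopic_id_of_deformation _ hcont hmaps h0 _ fun x => ?_
      change sc x _ = sc (sc x _) r
      rw [hH1 _ _ _ (Real.rpow_nonneg (hApos hr0 x x.2).le _) hr]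
      congr 1
      ring
    have hρι : ρ.comp ι = ContinuousMap.id A1 := by
      ext u
      exact hproj u (hA1M u u.2) r hr0
    exact ContinuousMap.HomotopyEquiv.contractibleSpace
      ⟨ρ, ι, hιρ.symm, hρι ▸ ContinuousMap.Homotopic.refl _⟩
end

section
/- Let W be a real normed vector space equipped with a continuous map W × [0,∞) → W, (u,t) ↦ u_t, satisfying (H1) (u_{t1})_{t2} = u_{t1·t2} for all u ∈ W and t1, t2 ≥ 0, and (H3) u_0 = 0 and u_1 = u for all u ∈ W. Let s > 0 and let I : W → ℝ be continuous with I(0) = 0, I(u) > 0 for every u ≠ 0, and I(u_t) = t^s·I(u) for all u, t. Set M = {u ∈ W : I(u) = 1}, let B_0 ⊆ M be nonempty, let 0 < ρ < ρ′, and set B* = {w_t : w ∈ B_0, 0 ≤ t ≤ ρ}. Then W ∖ B* ⊆ W ∖ {0}, and the map H : (W ∖ B*) × [0,1] → W ∖ B*, H(u,τ) = u_{(1−τ) + τ·ρ′·I(u)^{−1/s}}, is well defined (it takes values in W ∖ B*) and continuous, with H(u,0) = u and I(H(u,1)) = (ρ′)^s for all u ∈ W ∖ B*, and H(u,τ) =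 u whenever I(u) = (ρ′)^s. In particular, W ∖ B* strongly deformation retracts onto the level set {u ∈ W : I(u) = (ρ′)^s}. -/
theorem Real.rpow_rpow_neg_one_div {r s : ℝ} (hr : 0 ≤ r) (hs : s ≠ 0) :
    (r ^ s) ^ (-1 / s) = r⁻¹ := by
  rw [← Real.rpow_mul hr, mul_div_cancel₀ _ hs, Real.rpow_neg_one]


/-- W \ B* strongly deformation retracts onto the level set {I = (ρ')^s}
via H(u,τ) = u_{(1-τ) + τ ρ' I(u)^{-1/s}}. -/
theorem stmt_12 {W : Type*} [NormedAddCommGroup W] [NormedSpace ℝ W]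
    (sc : W → ℝ → W)
    (hsc_cont : ContinuousOn (fun p : W × ℝ => sc p.1 p.2) (Set.univ ×ˢ Set.Ici (0:ℝ)))
    (hH1 : ∀ (u : W) (t1 t2 : ℝ), 0 ≤ t1 → 0 ≤ t2 → sc (sc u t1) t2 = sc u (t1 * t2))
    (hH3a : ∀ u : W, sc u 0 = 0) (hH3b : ∀ u : W, sc u 1 = u)
    (s : ℝ) (hs : 0 < s)
    (I : W → ℝ) (hIcont : Continuous I) (hI0 : I 0 = 0)
    (hIpos : ∀ u : W, u ≠ 0 → 0 < I u)
    (hIscale : ∀ (u : W) (t : ℝ), 0 ≤ t → I (sc u t) = t ^ s * I u)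
    (B0 : Set W) (hB0M : B0 ⊆ {u : W | I u = 1}) (hB0ne : B0.Nonempty)
    (ρ ρ' : ℝ) (hρ : 0 < ρ) (hρρ' : ρ < ρ')
    (Bstar : Set W)
    (hBstar : Bstar = {x : W | ∃ w ∈ B0, ∃ t : ℝ, 0 ≤ t ∧ t ≤ ρ ∧ x = sc w t}) :
    -- W \ B* ⊆ W \ {0}
    (∀ u : W, u ∉ Bstar → u ≠ 0) ∧
    -- H maps (W \ B*) × [0,1] into W \ B*
    (∀ u : W, u ∉ Bstar → ∀ τ ∈ Set.Icc (0:ℝ) 1,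
      sc u ((1 - τ) + τ * ρ' * (I u ^ (-1/s))) ∉ Bstar) ∧
    -- H is continuous
    ContinuousOn (fun p : W × ℝ => sc p.1 ((1 - p.2) + p.2 * ρ' * (I p.1 ^ (-1/s))))
      ({u : W | u ∉ Bstar} ×ˢ Set.Icc (0:ℝ) 1) ∧
    -- H(u,0) = u
    (∀ u : W, u ∉ Bstar → sc u ((1 - (0:ℝ)) + 0 * ρ' * (I u ^ (-1/s))) = u) ∧
    -- I(H(u,1)) = (ρ')^s
    (∀ u : W, u ∉ Bstar →
      I (sc u ((1 - (1:ℝ)) + 1 * ρ' * (I u ^ (-1/s)))) = ρ' ^ s) ∧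
    -- the level set {I = (ρ')^s} lies in W \ B* and is fixed by H
    (∀ u : W, I u = ρ' ^ s → u ∉ Bstar ∧
      ∀ τ ∈ Set.Icc (0:ℝ) 1, sc u ((1 - τ) + τ * ρ' * (I u ^ (-1/s))) = u) := by
  have hρ' : 0 < ρ' := hρ.trans hρρ'
  have hne : ∀ u : W, u ∉ Bstar → u ≠ 0 := by
    rintro u hu rfl
    obtain ⟨w, hw⟩ := hB0ne
    exact hu (hBstar ▸ ⟨w, hw, 0, le_rfl, hρ.le, (hH3a w).symm⟩)
  have hpos : ∀ u : W, u ∉ Bstar → 0 < I u := fun u hu => hIpos u (hne u hu)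
  have hparam : ∀ u : W, u ∉ Bstar → ∀ τ ∈ Set.Icc (0:ℝ) 1,
      0 < (1 - τ) + τ * ρ' * (I u ^ (-1/s)) := by
    rintro u hu τ ⟨h0, h1⟩
    have hc : 0 < ρ' * I u ^ (-1/s) := mul_pos hρ' (Real.rpow_pos_of_pos (hpos u hu) _)
    rw [mul_assoc]
    rcases h0.eq_or_lt with rfl | h0
    · norm_num
    · linarith [mul_pos h0 hc]
  refine ⟨hne, ?_, ?_, ?_, ?_, ?_⟩
  · intro u hu τ hτ hmem
    have ha := hparam u hu τ hτ
    set a := (1 - τ) + τ * ρ' * (I u ^ (-1/s)) with ha_def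
    rw [hBstar] at hmem
    obtain ⟨w, hw, t, ht0, htρ, heq⟩ := hmem
    have hu_eq : u = sc w (t * a⁻¹) := by
      rw [← hH1 w t a⁻¹ ht0 (inv_nonneg.2 ha.le), ← heq,
        hH1 u a a⁻¹ ha.le (inv_nonneg.2 ha.le), mul_inv_cancel₀ ha.ne', hH3b]
    have hr0 : 0 ≤ t * a⁻¹ := mul_nonneg ht0 (inv_nonneg.2 ha.le)
    have hr : ρ < t * a⁻¹ := by
      by_contra! hle
      exact hu (hBstar ▸ ⟨w, hw, _, hr0, hle, hu_eq⟩)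
    have hI : I u = (t * a⁻¹) ^ s := by
      rw [hu_eq, hIscale _ _ hr0, hB0M hw, mul_one]
    rw [hI, Real.rpow_rpow_neg_one_div hr0 hs.ne'] at ha_def
    have hta : t = a * (t * a⁻¹) := by field_simp
    generalize t * a⁻¹ = r at *
    have hr_pos : 0 < r := hρ.trans hr
    have ht : t = (1 - τ) * r + τ * ρ' := by
      rw [hta, ha_def]
      field_simp
    nlinarith [hτ.1, hτ.2, lt_min hr hρρ', min_le_left r ρ', min_le_right r ρ',
      mul_le_mul_of_nonneg_left (min_le_left r ρ') (sub_nonneg.2 hτ.2),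
      mul_le_mul_of_nonneg_left (min_le_right r ρ') hτ.1]
  · have hg : ContinuousOn
        (fun p : W × ℝ => (p.1, (1 - p.2) + p.2 * ρ' * (I p.1 ^ (-1/s))))
        ({u : W | u ∉ Bstar} ×ˢ Set.Icc (0:ℝ) 1) := by
      have hI : ContinuousOn (fun p : W × ℝ => I p.1 ^ (-1/s))
          ({u : W | u ∉ Bstar} ×ˢ Set.Icc (0:ℝ) 1) :=
        (hIcont.comp continuous_fst).continuousOn.rpow_const
          fun p hp => Or.inl (hpos p.1 hp.1).ne'
      fun_prop
    exact hsc_cont.comp hg fun p hp => ⟨trivial, (hparam p.1 hp.1 p.2 hp.2).le⟩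
  · intro u _
    simp [hH3b]
  · intro u hu
    have hc := Real.rpow_nonneg (hpos u hu).le (-1/s)
    rw [sub_self, zero_add, one_mul, hIscale _ _ (mul_nonneg hρ'.le hc),
      Real.mul_rpow hρ'.le hc, ← Real.rpow_mul (hpos u hu).le,
      div_mul_cancel₀ _ hs.ne', Real.rpow_neg_one, mul_assoc,
      inv_mul_cancel₀ (hpos u hu).ne', mul_one]
  · intro u hu
    refine ⟨fun hmem => ?_, fun τ _ => ?_⟩
    · rw [hBstar] at hmem
      obtain ⟨w, hw, t, ht0, htρ, rfl⟩ := hmem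
      rw [hIscale _ _ ht0, hB0M hw, mul_one] at hu
      exact (Real.rpow_lt_rpow ht0 (htρ.trans_lt hρρ') hs).ne hu
    · rw [hu, Real.rpow_rpow_neg_one_div hρ'.le hs.ne', mul_assoc,
        mul_inv_cancel₀ hρ'.ne', mul_one, sub_add_cancel, hH3b]
end

section
/- Let W be a reflexive real Banach space (so every bounded sequence in W has a weakly convergent subsequence), equipped with a continuous map W × [0,∞) → W, (u,t) ↦ u_t, satisfying (H1) (u_{t1})_{t2} = u_{t1·t2} for all u ∈ W and t1, t2 ≥ 0, (H3) u_0 = 0 and u_1 = u for all u ∈ W, and (H4) (u,t) ↦ u_t maps bounded subsets of W × [0,∞) to bounded subsets of W. Let s > 0 and let J : W → ℝ be weakly sequentially continuous with J(0) = 0 and J(u_t) = t^s·J(u) for all u ∈ W, t ≥ 0. Let A_0 ⊆ W be a nonempty bounded set with inf_{v∈A_0} J(v) ≥ ε for some ε > 0, let 0 < r ≤ R, and set D = {v_t : v ∈ A_0, r ≤ t ≤ R}. Then J(u) ≥ r^s·ε > 0 for every u ∈ D, D is bounded, and every sequence in D has a subsequence converging weakly to a nonzero element of W. -/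
/-- D = {v_t : v ∈ A₀, r ≤ t ≤ R} is bounded, J ≥ r^s ε > 0 on D, and D
is weakly compact in W \ {0}. -/
theorem stmt_14 {W : Type*} [NormedAddCommGroup W] [NormedSpace ℝ W] [CompleteSpace W]
    -- reflexivity: every bounded sequence has a weakly convergent subsequence
    (hrefl : ∀ u : ℕ → W, (∃ C : ℝ, ∀ n, ‖u n‖ ≤ C) →
      ∃ (v : W) (φ : ℕ → ℕ), StrictMono φ ∧ WeakConv (u ∘ φ) v)
    (sc : W → ℝ → W)
    (hsc_cont : ContinuousOn (fun p : W × ℝ => sc p.1 p.2) (Set.univ ×ˢ Set.Ici (0:ℝ)))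
    (hH1 : ∀ (u : W) (t1 t2 : ℝ), 0 ≤ t1 → 0 ≤ t2 → sc (sc u t1) t2 = sc u (t1 * t2))
    (hH3a : ∀ u : W, sc u 0 = 0) (hH3b : ∀ u : W, sc u 1 = u)
    -- (H4): the scaling maps bounded sets to bounded sets
    (hH4 : ∀ C : ℝ, ∃ C' : ℝ, ∀ (u : W) (t : ℝ), ‖u‖ ≤ C → 0 ≤ t → t ≤ C →
      ‖sc u t‖ ≤ C')
    (s : ℝ) (hs : 0 < s)
    (J : W → ℝ) (hJ0 : J 0 = 0)
    (hJwc : ∀ (u : ℕ → W) (v : W), WeakConv u v →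
      Filter.Tendsto (fun n => J (u n)) Filter.atTop (nhds (J v)))
    (hJscale : ∀ (u : W) (t : ℝ), 0 ≤ t → J (sc u t) = t ^ s * J u)
    (A0 : Set W) (hA0ne : A0.Nonempty)
    (hA0bdd : ∃ C : ℝ, ∀ v ∈ A0, ‖v‖ ≤ C)
    (ε : ℝ) (hε : 0 < ε) (hA0J : ∀ v ∈ A0, ε ≤ J v)
    (r R : ℝ) (hr : 0 < r) (hrR : r ≤ R)
    (D : Set W)
    (hD : D = {x : W | ∃ v ∈ A0, ∃ t : ℝ, r ≤ t ∧ t ≤ R ∧ x = sc v t}) :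
    -- J ≥ r^s ε > 0 on D
    (0 < r ^ s * ε) ∧ (∀ u ∈ D, r ^ s * ε ≤ J u) ∧
    -- D is bounded
    (∃ C : ℝ, ∀ u ∈ D, ‖u‖ ≤ C) ∧
    -- D is weakly compact in W \ {0}
    (∀ u : ℕ → W, (∀ n, u n ∈ D) →
      ∃ v : W, v ≠ 0 ∧ ∃ φ : ℕ → ℕ, StrictMono φ ∧ WeakConv (u ∘ φ) v) := by
  have hrs : 0 < r ^ s * ε := mul_pos (Real.rpow_pos_of_pos hr s) hε
  have hJD : ∀ u ∈ D, r ^ s * ε ≤ J u := by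
    rw [hD]
    rintro _ ⟨v, hv, t, hrt, -, rfl⟩
    rw [hJscale v t (hr.le.trans hrt)]
    exact mul_le_mul (Real.rpow_le_rpow hr.le hrt hs.le) (hA0J v hv) hε.le
      (Real.rpow_nonneg (hr.le.trans hrt) s)
  have hDbdd : ∃ C : ℝ, ∀ u ∈ D, ‖u‖ ≤ C := by
    obtain ⟨C, hC⟩ := hA0bdd
    obtain ⟨C', hC'⟩ := hH4 (max C R)
    refine ⟨C', ?_⟩
    rw [hD]
    rintro _ ⟨v, hv, t, hrt, htR, rfl⟩
    exact hC' v t ((hC v hv).trans (le_max_left _ _)) (hr.le.trans hrt)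
      (htR.trans (le_max_right _ _))
  refine ⟨hrs, hJD, hDbdd, fun u hu => ?_⟩
  obtain ⟨C, hC⟩ := hDbdd
  obtain ⟨v, φ, hφ, hconv⟩ := hrefl u ⟨C, fun n => hC _ (hu n)⟩
  have hJv : r ^ s * ε ≤ J v :=
    ge_of_tendsto' (hJwc _ _ hconv) fun n => hJD _ (hu (φ n))
  refine ⟨v, ?_, φ, hφ, hconv⟩
  rintro rfl
  linarith
end

section
/- Let W be a real normed vector space equipped with a continuous map W × [0,∞) → W, (u,t) ↦ u_t, satisfying (H1) (u_{t1})_{t2} = u_{t1·t2} for all u ∈ W and t1, t2 ≥ 0, (H3) u_0 = 0 and u_1 = u for all u ∈ W, and (H4) (u,t) ↦ u_t maps bounded subsets of W × [0,∞) to bounded subsets of W. Let s > 0 and let I, J : W → ℝ satisfy: I is continuous and coercive (I(u) → ∞ as ‖u‖ → ∞) with I(0) = 0, I(u) > 0 for u ≠ 0, I(u_t) = t^s·I(u) and J(u_t) = t^s·J(u) for all u, t, and J(u) ≥ 0 for all u. Set M = {u ∈ W : I(u) = 1}. Let 0 < λ < Λ and B_0 = {u ∈ M : J(u) ≤ 1/Λ}.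 Let F : W → ℝ be bounded on bounded subsets of W, and let G : W → ℝ satisfy: there exists η > s such that for every bounded set S ⊆ W and every ε > 0 there is δ > 0 with |G(u_t)| ≤ ε·t^η for all u ∈ S and all t ∈ (0,δ). Then there exist ρ > 0, μ* > 0, and c > 0 such that for every μ ∈ (0, μ*) and every u ∈ B_0, I(u_ρ) − λ·J(u_ρ) − μ·F(u_ρ) − G(u_ρ) ≥ c. -/
/-- a uniform positive lower bound for Φ on {u_ρ : u ∈ B₀} for suitable
ρ > 0 and small μ > 0. -/
theorem stmt_15 {W : Type*} [NormedAddCommGroup W] [NormedSpace ℝ W]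
    (sc : W → ℝ → W)
    (hsc_cont : ContinuousOn (fun p : W × ℝ => sc p.1 p.2) (Set.univ ×ˢ Set.Ici (0:ℝ)))
    (hH1 : ∀ (u : W) (t1 t2 : ℝ), 0 ≤ t1 → 0 ≤ t2 → sc (sc u t1) t2 = sc u (t1 * t2))
    (hH3a : ∀ u : W, sc u 0 = 0) (hH3b : ∀ u : W, sc u 1 = u)
    -- (H4): the scaling maps bounded sets to bounded sets
    (hH4 : ∀ C : ℝ, ∃ C' : ℝ, ∀ (u : W) (t : ℝ), ‖u‖ ≤ C → 0 ≤ t → t ≤ C →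
      ‖sc u t‖ ≤ C')
    (s : ℝ) (hs : 0 < s)
    (I J : W → ℝ) (hIcont : Continuous I)
    (hIcoercive : ∀ c : ℝ, ∃ R : ℝ, ∀ u : W, R ≤ ‖u‖ → c ≤ I u)
    (hI0 : I 0 = 0) (hIpos : ∀ u : W, u ≠ 0 → 0 < I u)
    (hIscale : ∀ (u : W) (t : ℝ), 0 ≤ t → I (sc u t) = t ^ s * I u)
    (hJscale : ∀ (u : W) (t : ℝ), 0 ≤ t → J (sc u t) = t ^ s * J u)
    (hJnonneg : ∀ u : W, 0 ≤ J u)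
    (lam Lam : ℝ) (hlam : 0 < lam) (hlamLam : lam < Lam)
    (B0 : Set W) (hB0 : B0 = {u : W | I u = 1 ∧ J u ≤ 1/Lam})
    (F : W → ℝ)
    -- F is bounded on bounded sets
    (hF : ∀ C : ℝ, ∃ C' : ℝ, ∀ u : W, ‖u‖ ≤ C → |F u| ≤ C')
    (G : W → ℝ) (η : ℝ) (hη : s < η)
    -- (G1): G(u_t) = o(t^η) as t → 0⁺, uniformly on bounded sets
    (hG : ∀ C : ℝ, ∀ ε : ℝ, 0 < ε → ∃ δ : ℝ, 0 < δ ∧ ∀ u : W, ‖u‖ ≤ C →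
      ∀ t : ℝ, 0 < t → t < δ → |G (sc u t)| ≤ ε * t ^ η) :
    ∃ ρ : ℝ, 0 < ρ ∧ ∃ μstar : ℝ, 0 < μstar ∧ ∃ c : ℝ, 0 < c ∧
      ∀ μ : ℝ, 0 < μ → μ < μstar → ∀ u ∈ B0,
        c ≤ I (sc u ρ) - lam * J (sc u ρ) - μ * F (sc u ρ) - G (sc u ρ) := by
  have hLam : 0 < Lam := hlam.trans hlamLam
  obtain ⟨d, hd⟩ : ∃ d : ℝ, d = 1 - lam * (1 / Lam) := ⟨_, rfl⟩
  have hd0 : 0 < d := by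
    rw [hd, mul_one_div, sub_pos, div_lt_one hLam]
    exact hlamLam
  obtain ⟨R, hR⟩ := hIcoercive 2
  obtain ⟨δ, hδ, hGδ⟩ := hG R (d / 4) (by positivity)
  obtain ⟨C, hC⟩ := hH4 (max R 1)
  obtain ⟨K, hK⟩ := hF C
  obtain ⟨ρ, hρ0, hρ⟩ := exists_between (lt_min hδ one_pos)
  have hρδ : ρ < δ := hρ.trans_le (min_le_left _ _)
  have hρ1 : ρ ≤ 1 := hρ.le.trans (min_le_right _ _)
  have hp : 0 < ρ ^ s := Real.rpow_pos_of_pos hρ0 s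
  have hpη : ρ ^ η ≤ ρ ^ s := Real.rpow_le_rpow_of_exponent_ge hρ0 hρ1 hη.le
  have hK' : 0 < |K| + 1 := by positivity
  refine ⟨ρ, hρ0, ρ ^ s * d / 4 / (|K| + 1), by positivity, ρ ^ s * d / 2, by positivity, ?_⟩
  intro μ hμ hμlt u hu
  rw [hB0] at hu
  obtain ⟨hIu, hJu⟩ := hu
  have huR : ‖u‖ ≤ R := by
    by_contra! h
    linarith [hR u h.le]
  have hFu : |F (sc u ρ)| ≤ |K| + 1 := by
    have h := hK _ (hC u ρ (huR.trans (le_max_left _ _)) hρ0.le (hρ1.trans (le_max_right _ _)))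
    linarith [le_abs_self K]
  have hμF : μ * F (sc u ρ) ≤ ρ ^ s * d / 4 :=
    calc μ * F (sc u ρ) ≤ μ * (|K| + 1) :=
          mul_le_mul_of_nonneg_left ((le_abs_self _).trans hFu) hμ.le
      _ ≤ ρ ^ s * d / 4 := ((lt_div_iff₀ hK').1 hμlt).le
  have hGu : G (sc u ρ) ≤ d / 4 * ρ ^ s :=
    (le_abs_self _).trans ((hGδ u huR ρ hρ0 hρδ).trans
      (mul_le_mul_of_nonneg_left hpη (by positivity)))
  have hmain : ρ ^ s * d ≤ ρ ^ s * (1 - lam * J u) := by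
    have := mul_le_mul_of_nonneg_left hJu hlam.le
    exact mul_le_mul_of_nonneg_left (by linarith) hp.le
  rw [hIscale u ρ hρ0.le, hJscale u ρ hρ0.le, hIu]
  linarith
end

section
/- Let W be a reflexive real Banach space equipped with a continuous map W × [0,∞) → W, (u,t) ↦ u_t, satisfying (H1) (u_{t1})_{t2} = u_{t1·t2} for all u ∈ W and t1, t2 ≥ 0, (H3) u_0 = 0 and u_1 = u for all u ∈ W, and (H4) (u,t) ↦ u_t maps bounded subsets of W × [0,∞) to bounded subsets of W. Let s > 0 and let I, J : W → ℝ be continuous even functions with I(0) = J(0) = 0, J(u) > 0 for u ≠ 0, I coercive, I(u_t) = t^s·I(u) and J(u_t) = t^s·J(u) for all u, t, with t ↦ I(t·u) and t ↦ J(t·u) strictly increasing on (0,∞) for every u ≠ 0, I weakly sequentially lower semicontinuous, and J weakly sequentially continuous. Set M = {u ∈ W : I(u) = 1} and let π_rad be the radial projection onto M. Call a set K ⊆ W ∖ {0} weakly compact in W ∖ {0} if every sequence in K has a subsequence converging weakly to a nonzero element of W. Let λ̄ > 0, A_0 = {u ∈ M : J(u) ≥ 1/λ̄} nonempty, w̃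 ∈ M with J(w̃) < 1/λ̄, and A_1 = {π_rad((1−τ)·v + τ·w̃) : v ∈ A_0, 0 ≤ τ ≤ 1}. Let F : W → ℝ be weakly sequentially continuous with F(0) = 0, F(u) > 0 for u ≠ 0, and such that for every weakly compact K ⊆ W ∖ {0} and every C > 0 there is δ > 0 with F(u_t) ≥ C·t^s for all u ∈ K and t ∈ (0,δ). Let G : W → ℝ satisfy G(0) = 0, G(u) > 0 for u ≠ 0, and for every weakly compact K ⊆ W ∖ {0} and every C > 0 there is T > 0 with G(u_t) ≥ C·t^s for all u ∈ K and t > T. Let λ ≥ λ̄, μ > 0, ρ > 0, and define Φ(u) = I(u) − λ·J(u) − μ·F(u) − G(u). Then there exist r ∈ (0,ρ) and R > ρ such that sup{Φ(u_r) : u ∈ A_1} < 0, sup{Φ(u_R) : u ∈ A_1} < 0, and sup{Φ(v_t) : v ∈ A_0, r ≤ t ≤ R} < 0. -/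
/-- A set K ⊆ W \ {0} is weakly compact in W \ {0} if every sequence in K has a
subsequence converging weakly to a nonzero element of W. -/
def WeaklyCompactAwayFromZero {W : Type*} [NormedAddCommGroup W] [NormedSpace ℝ W]
    (K : Set W) : Prop :=
  K ⊆ {u : W | u ≠ 0} ∧ ∀ u : ℕ → W, (∀ n, u n ∈ K) →
    ∃ v : W, v ≠ 0 ∧ ∃ φ : ℕ → ℕ, StrictMono φ ∧ WeakConv (u ∘ φ) v

open Filter Topology

section WeakCompactness

variable {W : Type*} [NormedAddCommGroup W] [NormedSpace ℝ W]

theorem WeakConv.comp_tendsto {u : ℕ → W} {l : W} (h : WeakConv u l) {φ : ℕ → ℕ}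
    (hφ : Tendsto φ atTop atTop) : WeakConv (u ∘ φ) l :=
  fun f => (h f).comp hφ

theorem WeakConv.const_smul {u : ℕ → W} {l : W} (h : WeakConv u l) (c : ℝ) :
    WeakConv (fun n => c • u n) (c • l) := by
  intro f
  simpa using (h f).const_mul c

/-- A bounded set on which a weakly sequentially continuous function vanishing at `0` is bounded
below by a positive constant is weakly compact away from `0`. -/
theorem WeaklyCompactAwayFromZero.of_bounded_of_le
    (hrefl : ∀ u : ℕ → W, (∃ C : ℝ, ∀ n, ‖u n‖ ≤ C) →
      ∃ (v : W) (φ : ℕ → ℕ), StrictMono φ ∧ WeakConv (u ∘ φ) v)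
    {J : W → ℝ} (hJ0 : J 0 = 0)
    (hJwc : ∀ (u : ℕ → W) (v : W), WeakConv u v →
      Tendsto (fun n => J (u n)) atTop (𝓝 (J v)))
    {K : Set W} {B c : ℝ} (hB : ∀ u ∈ K, ‖u‖ ≤ B) (hc : 0 < c) (hcJ : ∀ u ∈ K, c ≤ J u) :
    WeaklyCompactAwayFromZero K := by
  refine ⟨?_, fun u hu => ?_⟩
  · rintro u hu rfl
    linarith [hcJ 0 hu]
  · obtain ⟨v, φ, hφ, hv⟩ := hrefl u ⟨B, fun n => hB _ (hu n)⟩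
    refine ⟨v, ?_, φ, hφ, hv⟩
    rintro rfl
    have := ge_of_tendsto' (hJwc _ _ hv) fun n => hcJ _ (hu (φ n))
    linarith

/-- A positive weakly sequentially continuous function is bounded away from zero on a set that is
weakly compact away from `0`. -/
theorem WeaklyCompactAwayFromZero.exists_pos_le {K : Set W} (hK : WeaklyCompactAwayFromZero K)
    {f : W → ℝ} (hpos : ∀ u : W, u ≠ 0 → 0 < f u)
    (hwc : ∀ (u : ℕ → W) (v : W), WeakConv u v →
      Tendsto (fun n => f (u n)) atTop (𝓝 (f v))) :
    ∃ c : ℝ, 0 < c ∧ ∀ u ∈ K, c ≤ f u := by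
  by_contra! h
  choose u huK hu using fun n : ℕ => h (1 / ((n : ℝ) + 1)) Nat.one_div_pos_of_nat
  obtain ⟨v, hv0, φ, hφ, hv⟩ := hK.2 u huK
  have hlim : Tendsto (fun n => 1 / ((φ n : ℝ) + 1)) atTop (𝓝 0) :=
    tendsto_one_div_add_atTop_nhds_zero_nat.comp hφ.tendsto_atTop
  have := le_of_tendsto_of_tendsto' (hwc _ _ hv) hlim fun n => (hu (φ n)).le
  linarith [hpos v hv0]

theorem segment_combination_ne_zero {I J : W → ℝ}
    (hIeven : ∀ u : W, I (-u) = I u) (hJeven : ∀ u : W, J (-u) = J u)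
    (hI0 : I 0 = 0) (hJ0 : J 0 = 0)
    (hImono : ∀ u : W, u ≠ 0 → StrictMonoOn (fun t : ℝ => I (t • u)) (Set.Ioi (0:ℝ)))
    (hJmono : ∀ u : W, u ≠ 0 → StrictMonoOn (fun t : ℝ => J (t • u)) (Set.Ioi (0:ℝ)))
    {b : ℝ} (hb : 0 < b) {v w : W} (hw : I w = 1) (hwJ : J w < b) (hv : I v ≤ 1)
    (hvJ : b ≤ J v) {τ : ℝ} (hτ : τ ∈ Set.Icc (0:ℝ) 1) :
    (1 - τ) • v + τ • w ≠ 0 := by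
  intro h0
  have hw0 : w ≠ 0 := by
    rintro rfl
    linarith
  have hτ1 : 0 < 1 - τ := by
    refine lt_of_le_of_ne (by linarith [hτ.2]) fun h => hw0 ?_
    have : τ = 1 := by linarith
    simpa [this] using h0
  obtain ⟨a, ha⟩ : ∃ a, a = τ / (1 - τ) := ⟨_, rfl⟩
  have ha0 : 0 ≤ a := ha ▸ div_nonneg hτ.1 hτ1.le
  have hva : v = -(a • w) := by
    have h1 : (1 - τ) • v = -(τ • w) := eq_neg_of_add_eq_zero_left h0
    calc v = (1 - τ)⁻¹ • ((1 - τ) • v) := (inv_smul_smul₀ hτ1.ne' v).symm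
      _ = -(a • w) := by rw [h1, smul_neg, smul_smul, ha, div_eq_inv_mul]
  rw [hva, hIeven] at hv
  rw [hva, hJeven] at hvJ
  rcases ha0.eq_or_lt with rfl | hapos
  · rw [zero_smul, hJ0] at hvJ
    linarith
  rcases le_or_gt a 1 with h1 | h1
  · have := (hJmono w hw0).monotoneOn hapos (Set.mem_Ioi.2 one_pos) h1
    simp only [one_smul] at this
    linarith
  · have := hImono w hw0 (Set.mem_Ioi.2 one_pos) hapos h1
    simp only [one_smul] at this
    linarith

end WeakCompactness

/-- negativity of Φ on the sets {u_r : u ∈ A₁}, {u_R : u ∈ A₁} and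
{v_t : v ∈ A₀, r ≤ t ≤ R}. -/
theorem stmt_16 {W : Type*} [NormedAddCommGroup W] [NormedSpace ℝ W] [CompleteSpace W]
    -- reflexivity: every bounded sequence has a weakly convergent subsequence
    (hrefl : ∀ u : ℕ → W, (∃ C : ℝ, ∀ n, ‖u n‖ ≤ C) →
      ∃ (v : W) (φ : ℕ → ℕ), StrictMono φ ∧ WeakConv (u ∘ φ) v)
    (sc : W → ℝ → W)
    (hsc_cont : ContinuousOn (fun p : W × ℝ => sc p.1 p.2) (Set.univ ×ˢ Set.Ici (0:ℝ)))
    (hH1 : ∀ (u : W) (t1 t2 : ℝ), 0 ≤ t1 → 0 ≤ t2 → sc (sc u t1) t2 = sc u (t1 * t2))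
    (hH3a : ∀ u : W, sc u 0 = 0) (hH3b : ∀ u : W, sc u 1 = u)
    (hH4 : ∀ C : ℝ, ∃ C' : ℝ, ∀ (u : W) (t : ℝ), ‖u‖ ≤ C → 0 ≤ t → t ≤ C →
      ‖sc u t‖ ≤ C')
    (s : ℝ) (hs : 0 < s)
    (I J : W → ℝ) (hIcont : Continuous I) (hJcont : Continuous J)
    (hIeven : ∀ u : W, I (-u) = I u) (hJeven : ∀ u : W, J (-u) = J u)
    (hI0 : I 0 = 0) (hJ0 : J 0 = 0)
    (hJpos : ∀ u : W, u ≠ 0 → 0 < J u)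
    (hIcoercive : ∀ c : ℝ, ∃ R : ℝ, ∀ u : W, R ≤ ‖u‖ → c ≤ I u)
    (hIscale : ∀ (u : W) (t : ℝ), 0 ≤ t → I (sc u t) = t ^ s * I u)
    (hJscale : ∀ (u : W) (t : ℝ), 0 ≤ t → J (sc u t) = t ^ s * J u)
    (hImono : ∀ u : W, u ≠ 0 → StrictMonoOn (fun t : ℝ => I (t • u)) (Set.Ioi (0:ℝ)))
    (hJmono : ∀ u : W, u ≠ 0 → StrictMonoOn (fun t : ℝ => J (t • u)) (Set.Ioi (0:ℝ)))
    (hIwlsc : ∀ (u : ℕ → W) (v : W), WeakConv u v →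
      I v ≤ Filter.liminf (fun n => I (u n)) Filter.atTop)
    (hJwc : ∀ (u : ℕ → W) (v : W), WeakConv u v →
      Filter.Tendsto (fun n => J (u n)) Filter.atTop (nhds (J v)))
    -- the radial projection π_rad(u) = T(u) • u
    (T : W → ℝ) (hT : ∀ u : W, u ≠ 0 → 0 < T u ∧ I (T u • u) = 1)
    (lamb : ℝ) (hlamb : 0 < lamb)
    (A0 : Set W) (hA0 : A0 = {u : W | I u = 1 ∧ 1/lamb ≤ J u}) (hA0ne : A0.Nonempty)
    (w : W) (hwM : I w = 1) (hwJ : J w < 1/lamb)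
    (A1 : Set W)
    (hA1 : A1 = {x : W | ∃ v ∈ A0, ∃ τ ∈ Set.Icc (0:ℝ) 1,
      x = T ((1-τ) • v + τ • w) • ((1-τ) • v + τ • w)})
    (F : W → ℝ) (hF0 : F 0 = 0) (hFpos : ∀ u : W, u ≠ 0 → 0 < F u)
    (hFwc : ∀ (u : ℕ → W) (v : W), WeakConv u v →
      Filter.Tendsto (fun n => F (u n)) Filter.atTop (nhds (F v)))
    (hF1 : ∀ K : Set W, WeaklyCompactAwayFromZero K → ∀ C : ℝ, 0 < C →
      ∃ δ : ℝ, 0 < δ ∧ ∀ u ∈ K, ∀ t : ℝ, 0 < t → t < δ → C * t ^ s ≤ F (sc u t))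
    (G : W → ℝ) (hG0 : G 0 = 0) (hGpos : ∀ u : W, u ≠ 0 → 0 < G u)
    (hG3 : ∀ K : Set W, WeaklyCompactAwayFromZero K → ∀ C : ℝ, 0 < C →
      ∃ T0 : ℝ, 0 < T0 ∧ ∀ u ∈ K, ∀ t : ℝ, T0 < t → C * t ^ s ≤ G (sc u t))
    (lam μ ρ : ℝ) (hlam : lamb ≤ lam) (hμ : 0 < μ) (hρ : 0 < ρ)
    (Φ : W → ℝ) (hΦ : Φ = fun u => I u - lam * J u - μ * F u - G u) :
    ∃ r : ℝ, 0 < r ∧ r < ρ ∧ ∃ R : ℝ, ρ < R ∧ ∃ c : ℝ, c < 0 ∧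
      (∀ u ∈ A1, Φ (sc u r) ≤ c) ∧
      (∀ u ∈ A1, Φ (sc u R) ≤ c) ∧
      (∀ v ∈ A0, ∀ t : ℝ, r ≤ t → t ≤ R → Φ (sc v t) ≤ c) := by
  have hb : 0 < 1 / lamb := one_div_pos.2 hlamb
  have hIne : ∀ u : W, I u = 1 → u ≠ 0 := by
    rintro u hu rfl
    linarith
  have hJnn : ∀ u : W, 0 ≤ J u := fun u => by
    rcases eq_or_ne u 0 with rfl | h
    exacts [hJ0.ge, (hJpos u h).le]
  have hFnn : ∀ u : W, 0 ≤ F u := fun u => by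
    rcases eq_or_ne u 0 with rfl | h
    exacts [hF0.ge, (hFpos u h).le]
  have hGnn : ∀ u : W, 0 ≤ G u := fun u => by
    rcases eq_or_ne u 0 with rfl | h
    exacts [hG0.ge, (hGpos u h).le]
  obtain ⟨B, hB⟩ := hIcoercive 2
  have hMB : ∀ u : W, I u = 1 → ‖u‖ ≤ B := fun u hu => by
    by_contra! h
    linarith [hB u h.le]
  have hne : ∀ v : W, I v ≤ 1 → 1 / lamb ≤ J v → ∀ τ ∈ Set.Icc (0:ℝ) 1,
      (1 - τ) • v + τ • w ≠ 0 := fun v hv hvJ τ hτ =>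
    segment_combination_ne_zero hIeven hJeven hI0 hJ0 hImono hJmono hb hwM hwJ hv hvJ hτ
  -- The cone segments before projection are weakly compact away from zero.
  obtain ⟨Z, hZ⟩ : ∃ Z : Set W, Z = {x : W | ∃ v ∈ A0, ∃ τ ∈ Set.Icc (0:ℝ) 1,
      x = (1 - τ) • v + τ • w} := ⟨_, rfl⟩
  have hZK : WeaklyCompactAwayFromZero Z := by
    subst hZ hA0
    refine ⟨?_, fun x hx => ?_⟩
    · rintro x ⟨v, hv, τ, hτ, rfl⟩
      exact hne v hv.1.le hv.2 τ hτ
    choose v hv τ hτ hx using hx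
    obtain ⟨v', φ, hφ, hv'⟩ := hrefl v ⟨B, fun n => hMB _ (hv n).1⟩
    obtain ⟨t, ht, ψ, hψ, hτt⟩ :=
      isCompact_Icc.tendsto_subseq (x := τ ∘ φ) fun n => hτ (φ n)
    have hIv : I v' ≤ 1 := by
      have := hIwlsc _ _ hv'
      simpa [fun n => (hv n).1] using this
    have hJv : 1 / lamb ≤ J v' := ge_of_tendsto' (hJwc _ _ hv') fun n => (hv (φ n)).2
    refine ⟨(1 - t) • v' + t • w, hne v' hIv hJv t ht, φ ∘ ψ, hφ.comp hψ, fun f => ?_⟩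
    have h1 := (((tendsto_const_nhds (x := (1:ℝ))).sub hτt).mul
      ((hv'.comp_tendsto hψ.tendsto_atTop) f)).add (hτt.mul_const (f w))
    simpa [hx] using h1
  have hZB : ∀ x ∈ Z, ‖x‖ ≤ B := by
    subst hZ hA0
    rintro x ⟨v, hv, τ, hτ, rfl⟩
    have hconv := convex_closedBall (0 : W) B
    have := hconv (x := v) (by simpa using hMB v hv.1) (y := w) (by simpa using hMB w hwM)
      (a := 1 - τ) (b := τ) (by linarith [hτ.2]) hτ.1 (by ring)
    simpa using this
  -- The radial projection factor is bounded below on these segments.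
  obtain ⟨δ, hδ, hδI⟩ : ∃ δ > 0, ∀ x : W, ‖x‖ < δ → I x < 1 := by
    have : ∀ᶠ x in 𝓝 (0 : W), I x < 1 :=
      hIcont.continuousAt.eventually_lt_const (by simp [hI0])
    obtain ⟨δ, hδ, h⟩ := Metric.eventually_nhds_iff.1 this
    exact ⟨δ, hδ, fun x hx => h (by simpa using hx)⟩
  have hBpos : 0 < B := (norm_pos_iff.2 (hIne w hwM)).trans_le (hMB w hwM)
  have hTlow : ∀ x ∈ Z, δ / B ≤ T x := fun x hx => by
    obtain ⟨hT0, hT1⟩ := hT x (hZK.1 hx)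
    by_contra! h
    refine absurd hT1 (hδI _ ?_).ne
    rw [norm_smul, Real.norm_of_nonneg hT0.le]
    calc T x * ‖x‖ ≤ T x * B := by gcongr; exact hZB x hx
      _ < δ := (lt_div_iff₀ hBpos).1 h
  have hc : 0 < δ / B := div_pos hδ hBpos
  obtain ⟨c₁, hc₁, hc₁J⟩ := hZK.exists_pos_le (f := fun x => J ((δ / B) • x))
    (fun x hx => hJpos _ (smul_ne_zero hc.ne' hx))
    (fun u v h => hJwc _ _ (h.const_smul _))
  have hA1M : ∀ u ∈ A1, I u = 1 ∧ c₁ ≤ J u := by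
    subst hA1
    rintro u ⟨v, hv, τ, hτ, rfl⟩
    have hx : (1 - τ) • v + τ • w ∈ Z := hZ ▸ ⟨v, hv, τ, hτ, rfl⟩
    obtain ⟨hT0, hT1⟩ := hT _ (hZK.1 hx)
    exact ⟨hT1, (hc₁J _ hx).trans ((hJmono _ (hZK.1 hx)).monotoneOn hc hT0 (hTlow _ hx))⟩
  have hA1K : WeaklyCompactAwayFromZero A1 :=
    .of_bounded_of_le hrefl hJ0 hJwc (fun u hu => hMB u (hA1M u hu).1) hc₁
      fun u hu => (hA1M u hu).2
  obtain ⟨δ₁, hδ₁, hF⟩ := hF1 A1 hA1K (2 / μ) (by positivity)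
  obtain ⟨T₀, hT₀, hG⟩ := hG3 A1 hA1K 2 two_pos
  obtain ⟨r, hr, hr'⟩ := exists_between (lt_min hδ₁ hρ)
  obtain ⟨hrδ, hrρ⟩ := lt_min_iff.1 hr'
  obtain ⟨R, hR⟩ := exists_gt (max T₀ ρ)
  obtain ⟨hRT, hRρ⟩ := max_lt_iff.1 hR
  have hRpos : 0 < R := hρ.trans hRρ
  have hΦle : ∀ u : W, I u = 1 → ∀ t : ℝ, 0 ≤ t →
      Φ (sc u t) = t ^ s * (1 - lam * J u) - μ * F (sc u t) - G (sc u t) := fun u hu t ht => by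
    simp only [hΦ]
    rw [hIscale u t ht, hJscale u t ht, hu]
    ring
  have hlampos : 0 < lam := hlamb.trans_le hlam
  have hΦle' : ∀ u : W, I u = 1 → ∀ t : ℝ, 0 ≤ t →
      Φ (sc u t) ≤ t ^ s - μ * F (sc u t) - G (sc u t) := fun u hu t ht => by
    rw [hΦle u hu t ht]
    have : 0 ≤ t ^ s * (lam * J u) :=
      mul_nonneg (Real.rpow_nonneg ht s) (mul_nonneg hlampos.le (hJnn u))
    linarith
  -- The orbit of `A0` over `[r, R]` is weakly compact away from zero.
  obtain ⟨B₀, hB₀⟩ := hH4 (max B R)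
  have hA0K : WeaklyCompactAwayFromZero
      {x : W | ∃ v ∈ A0, ∃ t ∈ Set.Icc r R, x = sc v t} := by
    subst hA0
    refine .of_bounded_of_le hrefl hJ0 hJwc (B := B₀) (c := r ^ s * (1 / lamb)) ?_
      (by positivity) ?_
    · rintro x ⟨v, hv, t, ht, rfl⟩
      exact hB₀ v t ((hMB v hv.1).trans (le_max_left _ _)) (hr.le.trans ht.1)
        (ht.2.trans (le_max_right _ _))
    · rintro x ⟨v, hv, t, ht, rfl⟩
      rw [hJscale v t (hr.le.trans ht.1)]
      exact mul_le_mul (Real.rpow_le_rpow hr.le ht.1 hs.le) hv.2 hb.le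
        (Real.rpow_nonneg (hr.le.trans ht.1) s)
  obtain ⟨c₂, hc₂, hc₂F⟩ := hA0K.exists_pos_le hFpos hFwc
  have hrs : 0 < r ^ s := Real.rpow_pos_of_pos hr s
  have hRs : 0 < R ^ s := Real.rpow_pos_of_pos hRpos s
  refine ⟨r, hr, hrρ, R, hRρ, -(min (min (r ^ s) (R ^ s)) (μ * c₂)),
    neg_neg_of_pos (by positivity), fun u hu => ?_, fun u hu => ?_, fun v hv t hrt htR => ?_⟩
  · have h1 := hΦle' u (hA1M u hu).1 r hr.le
    have h2 : μ * (2 / μ * r ^ s) ≤ μ * F (sc u r) :=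
      mul_le_mul_of_nonneg_left (hF u hu r hr hrδ) hμ.le
    have h3 : μ * (2 / μ * r ^ s) = 2 * r ^ s := by field_simp
    have h4 : min (min (r ^ s) (R ^ s)) (μ * c₂) ≤ r ^ s :=
      (min_le_left _ _).trans (min_le_left _ _)
    linarith [hGnn (sc u r)]
  · have h1 := hΦle' u (hA1M u hu).1 R hRpos.le
    have h2 := hG u hu R hRT
    have h3 : min (min (r ^ s) (R ^ s)) (μ * c₂) ≤ R ^ s :=
      (min_le_left _ _).trans (min_le_right _ _)
    linarith [mul_nonneg hμ.le (hFnn (sc u R))]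
  · have h1 : μ * c₂ ≤ μ * F (sc v t) :=
      mul_le_mul_of_nonneg_left (hc₂F _ ⟨v, hv, t, ⟨hrt, htR⟩, rfl⟩) hμ.le
    have hv' : I v = 1 ∧ 1 / lamb ≤ J v := by simpa [hA0] using hv
    have ht : 0 ≤ t := hr.le.trans hrt
    have h2 : 1 ≤ lam * J v := by
      calc 1 = lamb * (1 / lamb) := by field_simp
        _ ≤ lam * J v := mul_le_mul hlam hv'.2 hb.le hlampos.le
    have h3 : t ^ s * (1 - lam * J v) ≤ 0 :=
      mul_nonpos_of_nonneg_of_nonpos (Real.rpow_nonneg ht s) (by linarith)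
    rw [hΦle v hv'.1 t ht]
    have h4 : min (min (r ^ s) (R ^ s)) (μ * c₂) ≤ μ * c₂ := min_le_right _ _
    linarith [hGnn (sc v t)]
end
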